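/- arXiv:0904.3045 — 6 statements merged into one kernel-verified Lean document; each statement's English description precedes it below -/
import Mathlib

section
/- If n does not divide m and m = kn + j with k ≥ 1 and 0 < j < n, then every module that is both m-strongly Gorenstein projective and n-strongly Gorenstein projective is j-strongly Gorenstein projective. -/
open CategoryTheory DirectSum

universe u

section Defs

variable (R : Type u) [Ring R]

/-- The ℤ-indexed complex `⋯ → P (i+1) → P i → ⋯` is exact, and it is the `n`-periodic
unrolling of an exact sequence `0 → M → P_{n-1} → ⋯ → P_0 → M → 0`; that is, `M` is
(isomorphic to) the syzygy of the complex at every position divisible by `n`. -/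
def IsPeriodicExact (n : ℕ) (M : Type u) [AddCommGroup M] [Module R M]
    (P : ℤ → ModuleCat.{u} R) (d : ∀ i : ℤ, P (i + 1) →ₗ[R] P i) : Prop :=
  (∀ i : ℤ, Function.Exact (d (i + 1)) (d i)) ∧
  ∀ k : ℤ, Nonempty (M ≃ₗ[R] LinearMap.range (d ((n : ℤ) * k)))

/-- The complex stays exact after applying `Hom_R(-, Q)` for every projective `Q`. -/
def IsHomExact (P : ℤ → ModuleCat.{u} R) (d : ∀ i : ℤ, P (i + 1) →ₗ[R] P i) : Prop :=
  ∀ (Q : ModuleCat.{u} R), Module.Projective R Q →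
    ∀ i : ℤ, Function.Exact (fun g : P i →ₗ[R] Q => g.comp (d i))
      (fun g : P (i + 1) →ₗ[R] Q => g.comp (d (i + 1)))

/-- `M` is `n`-strongly Gorenstein projective: there is an exact sequence
`0 → M → P_{n-1} → ⋯ → P_0 → M → 0` with all `P i` projective which stays exact
under `Hom_R(-, Q)` for every projective `Q` (encoded via its periodic unrolling). -/
def IsNSGProjective (n : ℕ) (M : Type u) [AddCommGroup M] [Module R M] : Prop :=
  ∃ (P : ℤ → ModuleCat.{u} R) (d : ∀ i : ℤ, P (i + 1) →ₗ[R] P i),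
    (∀ i, Module.Projective R (P i)) ∧ IsPeriodicExact R n M P d ∧ IsHomExact R P d

/-- `M` is Gorenstein projective: it is a syzygy of a totally acyclic complex of
projectives. -/
def IsGProjective (M : Type u) [AddCommGroup M] [Module R M] : Prop :=
  ∃ (P : ℤ → ModuleCat.{u} R) (d : ∀ i : ℤ, P (i + 1) →ₗ[R] P i),
    (∀ i, Module.Projective R (P i)) ∧ (∀ i : ℤ, Function.Exact (d (i + 1)) (d i)) ∧
    IsHomExact R P d ∧ Nonempty (M ≃ₗ[R] LinearMap.range (d 0))

/-- The projective dimension of `M` is at most `m`. -/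
def projDimLE : ℕ → ModuleCat.{u} R → Prop
  | 0, M => Module.Projective R M
  | m + 1, M => ∃ (F : ModuleCat.{u} R) (f : F →ₗ[R] M), Module.Projective R F ∧
      Function.Surjective f ∧ projDimLE m (ModuleCat.of R (LinearMap.ker f))

end Defs

section Helpers

variable {R : Type u} [Ring R]

/-- `0 → X → P → Y → 0` exact with `P` projective, and maps from `X` to projectives extend. -/
def SGStep (R : Type u) [Ring R] (X Y : Type u) [AddCommGroup X] [Module R X]
    [AddCommGroup Y] [Module R Y] : Prop :=
  ∃ (P : ModuleCat.{u} R) (ι : X →ₗ[R] P) (π : P →ₗ[R] Y), Module.Projective R P ∧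
    Function.Injective ι ∧ Function.Surjective π ∧ Function.Exact ι π ∧
    ∀ (Q : ModuleCat.{u} R), Module.Projective R Q → ∀ g : X →ₗ[R] Q,
      ∃ h : P →ₗ[R] Q, h.comp ι = g

/-- Stable isomorphism. -/
def SGStab (R : Type u) [Ring R] (X Y : Type u) [AddCommGroup X] [Module R X]
    [AddCommGroup Y] [Module R Y] : Prop :=
  ∃ (A B : ModuleCat.{u} R), Module.Projective R A ∧ Module.Projective R B ∧
    Nonempty ((X × A) ≃ₗ[R] (Y × B))

variable {X Y X' Y' : Type u} [AddCommGroup X] [Module R X] [AddCommGroup Y] [Module R Y]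
  [AddCommGroup X'] [Module R X'] [AddCommGroup Y'] [Module R Y']

theorem SGStep.congr (h : SGStep R X Y) (e : X ≃ₗ[R] X') (f : Y ≃ₗ[R] Y') : SGStep R X' Y' := by
  obtain ⟨P, ι, π, hP, hi, hs, he, hx⟩ := h
  refine ⟨P, ι.comp e.symm.toLinearMap, f.toLinearMap.comp π, hP, ?_, ?_, ?_, ?_⟩
  · simpa using hi
  · simpa using hs
  · intro p
    have := he p
    simp only [LinearMap.comp_apply, LinearEquiv.coe_coe, LinearEquiv.map_eq_zero_iff, this]
    constructor
    · rintro ⟨x, rfl⟩; exact ⟨e x, by simp⟩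
    · rintro ⟨x, rfl⟩; exact ⟨e.symm x, by simp⟩
  · intro Q hQ g
    obtain ⟨h, hh⟩ := hx Q hQ (g.comp e.toLinearMap)
    refine ⟨h, ?_⟩
    rw [← LinearMap.comp_assoc, hh]
    ext x; simp

theorem SGStep.add (h : SGStep R X Y) (A : ModuleCat.{u} R) (hA : Module.Projective R A) :
    SGStep R X (Y × A) := by
  obtain ⟨P, ι, π, hP, hi, hs, he, hx⟩ := h
  refine ⟨ModuleCat.of R (P × A), (LinearMap.inl R P A).comp ι, π.prodMap LinearMap.id,
    inferInstanceAs (Module.Projective R (P × A)), ?_, ?_, ?_, ?_⟩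
  · exact LinearMap.inl_injective.comp hi
  · exact hs.prodMap Function.surjective_id
  · rintro ⟨p, a⟩
    have := he p
    simp only [LinearMap.prodMap_apply, Prod.mk_eq_zero, this]
    constructor
    · rintro ⟨⟨x, rfl⟩, h⟩
      exact ⟨x, by simpa using Eq.symm h⟩
    · rintro ⟨x, h⟩
      simp only [LinearMap.comp_apply, LinearMap.inl_apply, Prod.mk.injEq] at h
      exact ⟨⟨x, h.1⟩, h.2.symm⟩
  · intro Q hQ g
    obtain ⟨h, hh⟩ := hx Q hQ g
    refine ⟨h.comp (LinearMap.fst R P A), ?_⟩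
    ext x
    exact LinearMap.congr_fun hh x

theorem SGStep.drop (B : ModuleCat.{u} R) (hB : Module.Projective R B)
    (h : SGStep R X (Y × B)) : SGStep R X Y := by
  obtain ⟨P, ι, π, hP, hi, hs, he, hx⟩ := h
  let q : P →ₗ[R] B := (LinearMap.snd R Y B).comp π
  have hq : Function.Surjective q := Prod.snd_surjective.comp hs
  obtain ⟨s, hs'⟩ := Module.projective_lifting_property q LinearMap.id hq
  have hsq : ∀ b, q (s b) = b := fun b => LinearMap.congr_fun hs' b
  have hC : Module.Projective R (LinearMap.ker q) := by
    refine Module.Projective.of_split (LinearMap.ker q).subtype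
      (LinearMap.codRestrict (LinearMap.ker q) (LinearMap.id - s.comp q) ?_) ?_
    · intro p; simp [hsq]
    · ext ⟨p, hp⟩
      rw [LinearMap.mem_ker] at hp
      simp [hp]
  have hιq : ∀ x, ι x ∈ LinearMap.ker q := fun x => by
    have : π (ι x) = 0 := he.apply_apply_eq_zero x
    simp [q, this]
  refine ⟨ModuleCat.of R (LinearMap.ker q), LinearMap.codRestrict _ ι hιq,
    ((LinearMap.fst R Y B).comp π).comp (LinearMap.ker q).subtype, hC, ?_, ?_, ?_, ?_⟩
  · intro a b hab
    exact hi (congrArg Subtype.val hab)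
  · intro y
    obtain ⟨p, hp⟩ := hs (y, 0)
    refine ⟨⟨p, ?_⟩, ?_⟩
    · simp [q, hp]
    · simp [hp]
  · rintro ⟨p, hp⟩
    have hp' : (π p).2 = 0 := hp
    constructor
    · intro h
      have h1 : (π p).1 = 0 := h
      obtain ⟨x, rfl⟩ := (he p).1 (Prod.ext h1 hp')
      exact ⟨x, rfl⟩
    · rintro ⟨x, h⟩
      have h1 : ι x = p := congrArg Subtype.val h
      subst h1
      have : π (ι x) = 0 := he.apply_apply_eq_zero x
      show (π (ι x)).1 = 0
      rw [this]; rfl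
  · intro Q hQ g
    obtain ⟨h, hh⟩ := hx Q hQ g
    refine ⟨h.comp (LinearMap.ker q).subtype, ?_⟩
    ext x
    exact LinearMap.congr_fun hh x

theorem schanuel_half {P P' : Type u} [AddCommGroup P] [Module R P] [AddCommGroup P'] [Module R P']
    (ι : X →ₗ[R] P) (π : P →ₗ[R] Y) (π' : P' →ₗ[R] Y) (hP : Module.Projective R P')
    (hi : Function.Injective ι) (hs : Function.Surjective π) (he : Function.Exact ι π) :
    Nonempty ((X × P') ≃ₗ[R]
      LinearMap.eqLocus (π.comp (LinearMap.fst R P P')) (π'.comp (LinearMap.snd R P P'))) := by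
  obtain ⟨t, ht⟩ := Module.projective_lifting_property π π' hs
  have ht' : ∀ p, π (t p) = π' p := fun p => LinearMap.congr_fun ht p
  have h0 : ∀ x, π (ι x) = 0 := he.apply_apply_eq_zero
  let F : (X × P') →ₗ[R] (P × P') := (ι.coprod t).prod (LinearMap.snd R X P')
  have hF : ∀ z, F z ∈ LinearMap.eqLocus (π.comp (LinearMap.fst R P P'))
      (π'.comp (LinearMap.snd R P P')) := by
    intro z
    simp [F, h0, ht', LinearMap.mem_eqLocus]
  refine ⟨LinearEquiv.ofBijective (LinearMap.codRestrict _ F hF) ⟨?_, ?_⟩⟩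
  · rintro ⟨x, p⟩ ⟨y, q⟩ h
    have h' : F (x, p) = F (y, q) := congrArg Subtype.val h
    have h2 : p = q := congrArg Prod.snd h'
    have h1 : ι x + t p = ι y + t q := by simpa [F] using congrArg Prod.fst h'
    subst h2
    rw [hi (add_right_cancel h1)]
  · rintro ⟨⟨p, p'⟩, hp⟩
    have hp' : π p = π' p' := hp
    obtain ⟨x, hx⟩ := (he (p - t p')).1 (by rw [map_sub, ht', hp', sub_self])
    refine ⟨(x, p'), Subtype.ext ?_⟩
    show F (x, p') = (p, p')
    simp [F, hx]

theorem SGStep.schanuel (h : SGStep R X Y) (h' : SGStep R X' Y) : SGStab R X X' := by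
  obtain ⟨P, ι, π, hP, hi, hs, he, -⟩ := h
  obtain ⟨P', ι', π', hP', hi', hs', he', -⟩ := h'
  obtain ⟨e⟩ := schanuel_half ι π π' hP' hi hs he
  obtain ⟨e'⟩ := schanuel_half ι' π' π hP hi' hs' he'
  suffices hsw : Nonempty
      (LinearMap.eqLocus (π.comp (LinearMap.fst R P P')) (π'.comp (LinearMap.snd R P P')) ≃ₗ[R]
      LinearMap.eqLocus (π'.comp (LinearMap.fst R P' P)) (π.comp (LinearMap.snd R P' P))) by
    obtain ⟨sw⟩ := hsw
    exact ⟨P', P, hP', hP, ⟨(e.trans sw).trans e'.symm⟩⟩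
  constructor
  refine LinearEquiv.ofSubmodules (LinearEquiv.prodComm R P P') _ _ ?_
  ext ⟨a, b⟩
  simp [LinearMap.mem_eqLocus, eq_comm]

theorem SGStep.trans_stab (h : SGStep R X Y) (e : SGStab R Y Y') : SGStep R X Y' := by
  obtain ⟨A, B, hA, hB, ⟨e⟩⟩ := e
  exact SGStep.drop B hB ((h.add A hA).congr (LinearEquiv.refl R X) e)

theorem SGStab.of_equiv (e : X ≃ₗ[R] Y) : SGStab R X Y :=
  ⟨ModuleCat.of R PUnit, ModuleCat.of R PUnit, inferInstanceAs (Module.Projective R PUnit.{u+1}),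
    inferInstanceAs (Module.Projective R PUnit.{u+1}), ⟨e.prodCongr (LinearEquiv.refl R _)⟩⟩

theorem SGStep.of_complex (P : ℤ → ModuleCat.{u} R) (d : ∀ i : ℤ, P (i + 1) →ₗ[R] P i)
    (hP : ∀ i, Module.Projective R (P i)) (hex : ∀ i : ℤ, Function.Exact (d (i + 1)) (d i))
    (hh : IsHomExact R P d) (i : ℤ) :
    SGStep R (LinearMap.range (d (i + 1))) (LinearMap.range (d i)) := by
  refine ⟨P (i + 1), (LinearMap.range (d (i + 1))).subtype, (d i).rangeRestrict, hP _,
    Subtype.val_injective, LinearMap.surjective_rangeRestrict _, ?_, ?_⟩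
  · intro p
    have := hex i p
    rw [← LinearMap.mem_ker, LinearMap.ker_rangeRestrict, LinearMap.mem_ker, this]
    simp
  · intro Q hQ g
    obtain ⟨h, hh⟩ := (hh Q hQ (i + 1) (g.comp (d (i + 1)).rangeRestrict)).1 (by
      ext x
      have : (d (i + 1)).rangeRestrict (d (i + 1 + 1) x) = 0 :=
        Subtype.ext ((hex (i + 1)).apply_apply_eq_zero x)
      simp [this])
    refine ⟨h, ?_⟩
    ext ⟨_, x, rfl⟩
    exact LinearMap.congr_fun hh x

theorem complex_of_steps (W : ℤ → ModuleCat.{u} R) (h : ∀ i, SGStep R (W (i + 1)) (W i)) :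
    ∃ (P : ℤ → ModuleCat.{u} R) (d : ∀ i : ℤ, P (i + 1) →ₗ[R] P i),
      (∀ i, Module.Projective R (P i)) ∧ (∀ i : ℤ, Function.Exact (d (i + 1)) (d i)) ∧
      IsHomExact R P d ∧ ∀ i, Nonempty (W (i + 1) ≃ₗ[R] LinearMap.range (d i)) := by
  choose P ι π hP hi hs he hx using h
  have hd0 : ∀ i x, π i (ι i x) = 0 := fun i => (he i).apply_apply_eq_zero
  refine ⟨P, fun i => (ι i).comp (π (i + 1)), hP, ?_, ?_, ?_⟩
  · intro i p
    simp only [LinearMap.comp_apply]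
    rw [map_eq_zero_iff _ (hi i), he (i + 1) p]
    constructor
    · rintro ⟨x, rfl⟩
      obtain ⟨y, rfl⟩ := hs (i + 1 + 1) x
      exact ⟨y, rfl⟩
    · rintro ⟨y, rfl⟩
      exact ⟨_, rfl⟩
  · intro Q hQ i g
    constructor
    · intro hg
      -- g vanishes on the image of ι (i+1), so it factors through π (i+1)
      have hg0 : ∀ x, g (ι (i + 1) x) = 0 := by
        intro x
        obtain ⟨y, rfl⟩ := hs (i + 1 + 1) x
        exact LinearMap.congr_fun hg y
      have hker : LinearMap.ker (π (i + 1)) ≤ LinearMap.ker g := by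
        intro p hp
        obtain ⟨x, rfl⟩ := (he (i + 1) p).1 hp
        exact hg0 x
      let e := (π (i + 1)).quotKerEquivOfSurjective (hs (i + 1))
      let g' : W (i + 1) →ₗ[R] Q := ((LinearMap.ker (π (i + 1))).liftQ g hker).comp
        e.symm.toLinearMap
      have hg' : ∀ p, g' (π (i + 1) p) = g p := by
        intro p
        have : e.symm (π (i + 1) p) = Submodule.Quotient.mk p := by
          rw [LinearEquiv.symm_apply_eq]; rfl
        simp only [g', LinearMap.comp_apply, LinearEquiv.coe_coe, this]
        rfl
      obtain ⟨h, hh⟩ := hx i Q hQ g'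
      refine ⟨h, ?_⟩
      ext p
      exact (LinearMap.congr_fun hh _).trans (hg' p)
    · rintro ⟨h, rfl⟩
      ext p
      simp [hd0]
  · intro i
    have : LinearMap.range ((ι i).comp (π (i + 1))) = LinearMap.range (ι i) :=
      LinearMap.range_comp_of_range_eq_top _ (LinearMap.range_eq_top.2 (hs (i + 1)))
    exact ⟨(LinearEquiv.ofInjective (ι i) (hi i)).trans (LinearEquiv.ofEq _ _ this.symm)⟩

theorem stab_iter (Z Z' : ℤ → ModuleCat.{u} R) (h : ∀ i, SGStep R (Z (i + 1)) (Z i))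
    (h' : ∀ i, SGStep R (Z' (i + 1)) (Z' i)) (h0 : SGStab R (Z 0) (Z' 0)) (t : ℕ) :
    SGStab R (Z t) (Z' t) := by
  induction t with
  | zero => simpa using h0
  | succ t ih =>
    push_cast
    exact ((h t).trans_stab ih).schanuel (h' t)

end Helpers

/-- If `n ∤ m` and `m = k * n + j` with `k ≥ 1` and `0 < j < n`, then every module that
is both `m`- and `n`-strongly Gorenstein projective is `j`-strongly Gorenstein
projective. -/
theorem nSGProjective_euclid (R : Type u) [Ring R] (m n k j : ℕ)
    (hndvd : ¬ n ∣ m) (hk : 1 ≤ k) (hj0 : 0 < j) (hjn : j < n) (hm : m = k * n + j)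
    (M : Type u) [AddCommGroup M] [Module R M]
    (hMm : IsNSGProjective R m M) (hMn : IsNSGProjective R n M) :
    IsNSGProjective R j M := by
  obtain ⟨P, d, hP, ⟨hex, hper⟩, hh⟩ := hMn
  obtain ⟨P', d', hP', ⟨hex', hper'⟩, hh'⟩ := hMm
  let Z : ℤ → ModuleCat.{u} R := fun i => ModuleCat.of R (LinearMap.range (d i))
  let Z' : ℤ → ModuleCat.{u} R := fun i => ModuleCat.of R (LinearMap.range (d' i))
  have hZ : ∀ i, SGStep R (Z (i + 1)) (Z i) := SGStep.of_complex P d hP hex hh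
  have hZ' : ∀ i, SGStep R (Z' (i + 1)) (Z' i) := SGStep.of_complex P' d' hP' hex' hh'
  have hn : ∀ k : ℤ, Nonempty (M ≃ₗ[R] Z (n * k)) := hper
  have hm' : ∀ k : ℤ, Nonempty (M ≃ₗ[R] Z' (m * k)) := hper'
  have eZ0 : Nonempty (M ≃ₗ[R] Z 0) := by
    have h := hn 0
    rw [mul_zero] at h
    exact h
  have eZ'0 : Nonempty (M ≃ₗ[R] Z' 0) := by
    have h := hm' 0
    rw [mul_zero] at h
    exact h
  obtain ⟨e0⟩ := eZ0
  obtain ⟨e0'⟩ := eZ'0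
  have hstab := stab_iter Z' Z hZ' hZ (SGStab.of_equiv (e0'.symm.trans e0)) (n * k)
  have hstep : SGStep R (Z' (((n * k : ℕ) : ℤ) + 1)) M := by
    obtain ⟨e⟩ := hn k
    refine ((hZ' _).trans_stab hstab).congr (LinearEquiv.refl R _) ?_
    push_cast
    exact e.symm
  obtain ⟨em⟩ : Nonempty (M ≃ₗ[R] Z' (((n * k : ℕ) : ℤ) + j)) := by
    have h1 : ((n * k : ℕ) : ℤ) + j = m * 1 := by rw [hm]; push_cast; ring
    rw [h1]; exact hm' 1
  have hj : (0 : ℤ) < j := by exact_mod_cast hj0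
  let V : ℤ → ModuleCat.{u} R := fun r =>
    if r = 0 then ModuleCat.of R M else Z' (((n * k : ℕ) : ℤ) + r)
  have hV0 : V 0 = ModuleCat.of R M := if_pos rfl
  have hV : ∀ r, r ≠ 0 → V r = Z' (((n * k : ℕ) : ℤ) + r) := fun r hr => if_neg hr
  -- every step up to the right endpoint of a period
  have hA : ∀ r : ℤ, 0 ≤ r → SGStep R (Z' (((n * k : ℕ) : ℤ) + (r + 1))) (V r) := by
    intro r hr
    by_cases h : r = 0
    · subst h
      rw [hV0, zero_add]
      exact hstep
    · rw [hV r h, ← add_assoc]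
      exact hZ' _
  have hW : ∀ i : ℤ, SGStep R (V ((i + 1 - 1) % j)) (V ((i - 1) % j)) := by
    intro i
    have hr0 := Int.emod_nonneg (i - 1) hj.ne'
    have hrj := Int.emod_lt_of_pos (i - 1) hj
    have hs := hA _ hr0
    have hmod : (i + 1 - 1) % (j : ℤ) = ((i - 1) % j + 1) % j := by
      rw [Int.emod_add_emod]; congr 1; ring
    rw [hmod]
    generalize (i - 1) % (j : ℤ) = r at *
    by_cases h : r + 1 = j
    · rw [h, Int.emod_self, hV0]
      rw [h] at hs
      exact hs.congr em.symm (LinearEquiv.refl R _)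
    · rw [Int.emod_eq_of_lt (by omega) (by omega), hV _ (by omega)]
      exact hs
  obtain ⟨C, δ, h1, h2, h3, h4⟩ := complex_of_steps (fun i => V ((i - 1) % j)) hW
  refine ⟨C, δ, h1, ⟨h2, fun l => ?_⟩, h3⟩
  have h5 : Nonempty (V (((j : ℤ) * l + 1 - 1) % j) ≃ₗ[R] LinearMap.range (δ (j * l))) :=
    h4 (j * l)
  have h6 : ((j : ℤ) * l + 1 - 1) % j = 0 := by simp
  rw [h6, hV0] at h5
  exact h5
end

section
/- For any positive integer n, a module that is both n-strongly Gorenstein projective and (n+1)-strongly Gorenstein projective is 1-strongly Gorenstein projective (i.e., strongly Gorenstein projective). -/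
open CategoryTheory DirectSum

universe u

section Helpers

variable {R : Type u} [Ring R]

lemma split_of_proj {K X P : Type u} [AddCommGroup K] [Module R K] [AddCommGroup X] [Module R X]
    [AddCommGroup P] [Module R P] [Module.Projective R P] (i : K →ₗ[R] X) (f : X →ₗ[R] P)
    (hi : Function.Injective i) (hf : Function.Surjective f) (h : Function.Exact i f) :
    Nonempty (X ≃ₗ[R] K × P) := by
  obtain ⟨l, hl⟩ := Module.projective_lifting_property f LinearMap.id hf
  exact ⟨(h.splitSurjectiveEquiv hi ⟨l, hl⟩).1⟩

/-- Half of the Schanuel lemma: the pullback is `K × Q`. -/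
lemma pullback_equiv {K P Q N : Type u} [AddCommGroup K] [Module R K] [AddCommGroup P] [Module R P]
    [AddCommGroup Q] [Module R Q] [AddCommGroup N] [Module R N] [Module.Projective R Q]
    (i : K →ₗ[R] P) (f : P →ₗ[R] N) (g : Q →ₗ[R] N)
    (hi : Function.Injective i) (hf : Function.Surjective f) (h : Function.Exact i f) :
    Nonempty (LinearMap.eqLocus (f.comp (LinearMap.fst R P Q)) (g.comp (LinearMap.snd R P Q))
      ≃ₗ[R] K × Q) := by
  refine split_of_proj
    (LinearMap.codRestrict _ ((LinearMap.inl R P Q).comp i) (fun k => ?_))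
    ((LinearMap.snd R P Q).comp (Submodule.subtype _)) ?_ ?_ ?_
  · simp [LinearMap.mem_eqLocus, h.apply_apply_eq_zero]
  · intro a b hab
    have := congrArg (fun x => x.1.1) hab
    exact hi this
  · intro q
    obtain ⟨p, hp⟩ := hf (g q)
    exact ⟨⟨(p, q), by simpa [LinearMap.mem_eqLocus] using hp⟩, rfl⟩
  · rintro ⟨⟨p, q⟩, hx⟩
    simp only [LinearMap.mem_eqLocus, LinearMap.comp_apply, LinearMap.fst_apply,
      LinearMap.snd_apply] at hx
    constructor
    · intro hq
      have hq : q = 0 := hq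
      subst hq
      obtain ⟨k, rfl⟩ := (h p).1 (by simpa using hx)
      exact ⟨k, rfl⟩
    · rintro ⟨k, hk⟩
      exact (congrArg (fun x => x.1.2) hk).symm

lemma schanuel {K L P Q N : Type u} [AddCommGroup K] [Module R K] [AddCommGroup L] [Module R L]
    [AddCommGroup P] [Module R P]
    [AddCommGroup Q] [Module R Q] [AddCommGroup N] [Module R N]
    [Module.Projective R P] [Module.Projective R Q]
    (i : K →ₗ[R] P) (f : P →ₗ[R] N) (j : L →ₗ[R] Q) (g : Q →ₗ[R] N)
    (hi : Function.Injective i) (hf : Function.Surjective f) (h : Function.Exact i f)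
    (hj : Function.Injective j) (hg : Function.Surjective g) (h' : Function.Exact j g) :
    Nonempty ((K × Q) ≃ₗ[R] L × P) := by
  obtain ⟨e1⟩ := pullback_equiv i f g hi hf h
  obtain ⟨e2⟩ := pullback_equiv j g f hj hg h'
  let s : LinearMap.eqLocus (f.comp (LinearMap.fst R P Q)) (g.comp (LinearMap.snd R P Q)) ≃ₗ[R]
      LinearMap.eqLocus (g.comp (LinearMap.fst R Q P)) (f.comp (LinearMap.snd R Q P)) :=
    { toFun := fun x => ⟨(x.1.2, x.1.1), x.2.symm⟩
      invFun := fun x => ⟨(x.1.2, x.1.1), x.2.symm⟩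
      map_add' := fun _ _ => rfl
      map_smul' := fun _ _ => rfl
      left_inv := fun _ => rfl
      right_inv := fun _ => rfl }
  exact ⟨e1.symm.trans (s.trans e2)⟩

/-- Schanuel for modules that are only stably isomorphic. -/
lemma schanuel_step {K L P Q Z W A B : Type u} [AddCommGroup K] [Module R K]
    [AddCommGroup L] [Module R L] [AddCommGroup P] [Module R P]
    [AddCommGroup Q] [Module R Q] [AddCommGroup Z] [Module R Z] [AddCommGroup W] [Module R W]
    [AddCommGroup A] [Module R A] [AddCommGroup B] [Module R B]
    [Module.Projective R P] [Module.Projective R Q]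
    [Module.Projective R A] [Module.Projective R B]
    (i : K →ₗ[R] P) (f : P →ₗ[R] Z) (j : L →ₗ[R] Q) (g : Q →ₗ[R] W)
    (hi : Function.Injective i) (hf : Function.Surjective f) (h : Function.Exact i f)
    (hj : Function.Injective j) (hg : Function.Surjective g) (h' : Function.Exact j g)
    (e : (Z × A) ≃ₗ[R] W × B) :
    Nonempty ((K × (Q × B)) ≃ₗ[R] L × (P × A)) := by
  refine schanuel ((LinearMap.inl R P A).comp i)
    (e.toLinearMap.comp (f.prodMap LinearMap.id))
    ((LinearMap.inl R Q B).comp j) (g.prodMap LinearMap.id) ?_ ?_ ?_ ?_ ?_ ?_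
  · exact LinearMap.inl_injective.comp hi
  · exact e.surjective.comp (hf.prodMap Function.surjective_id)
  · rintro ⟨p, a⟩
    have := h p
    simp only [LinearMap.comp_apply, LinearEquiv.coe_coe, LinearEquiv.map_eq_zero_iff,
      LinearMap.prodMap_apply, LinearMap.id_apply, Prod.mk_eq_zero, this, Set.mem_range,
      LinearMap.inl_apply, Prod.mk.injEq]
    grind
  · exact LinearMap.inl_injective.comp hj
  · exact hg.prodMap Function.surjective_id
  · rintro ⟨p, a⟩
    have := h' p
    simp only [LinearMap.comp_apply,
      LinearMap.prodMap_apply, LinearMap.id_apply, Prod.mk_eq_zero, this, Set.mem_range,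
      LinearMap.inl_apply, Prod.mk.injEq]
    grind

/-- Cancelling projective summands in the quotient term. -/
lemma cut_down {K Q W M A B : Type u} [AddCommGroup K] [Module R K]
    [AddCommGroup Q] [Module R Q] [AddCommGroup W] [Module R W] [AddCommGroup M] [Module R M]
    [AddCommGroup A] [Module R A] [AddCommGroup B] [Module R B]
    [Module.Projective R Q] [Module.Projective R A] [Module.Projective R B]
    (j : K →ₗ[R] Q) (g : Q →ₗ[R] W)
    (hj : Function.Injective j) (hg : Function.Surjective g) (h : Function.Exact j g)
    (e : (M × A) ≃ₗ[R] W × B) :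
    ∃ (P : ModuleCat.{u} R) (i : K →ₗ[R] P) (f : P →ₗ[R] M), Module.Projective R P ∧
      Function.Injective i ∧ Function.Surjective f ∧ Function.Exact i f := by
  let φ : (Q × B) →ₗ[R] M × A := e.symm.toLinearMap.comp (g.prodMap LinearMap.id)
  have hφ : Function.Surjective φ := e.symm.surjective.comp (hg.prodMap Function.surjective_id)
  have hker : ∀ x, φ x = 0 ↔ ∃ k, (j k, 0) = x := by
    rintro ⟨q, b⟩
    have := h q
    simp only [φ, LinearMap.comp_apply, LinearEquiv.coe_coe, LinearEquiv.map_eq_zero_iff,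
      LinearMap.prodMap_apply, LinearMap.id_apply, Prod.mk_eq_zero, this, Set.mem_range,
      Prod.mk.injEq]
    grind
  let ψ : (Q × B) →ₗ[R] A := (LinearMap.snd R M A).comp φ
  have hψ : Function.Surjective ψ := (LinearMap.snd_surjective (R := R) (M := M) (M₂ := A)).comp hφ
  obtain ⟨e'⟩ := split_of_proj (LinearMap.ker ψ).subtype ψ (Submodule.subtype_injective _) hψ
    (LinearMap.exact_subtype_ker_map ψ)
  refine ⟨ModuleCat.of R (LinearMap.ker ψ),
    LinearMap.codRestrict _ ((LinearMap.inl R Q B).comp j) (fun k => ?_),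
    (LinearMap.fst R M A).comp (φ.comp (Submodule.subtype _)), ?_, ?_, ?_, ?_⟩
  · have : φ (j k, 0) = 0 := (hker _).2 ⟨k, rfl⟩
    simp [ψ, this]
  · refine Module.Projective.of_split (P := LinearMap.ker ψ) (M := Q × B)
      (e'.symm.toLinearMap.comp (LinearMap.inl R _ A))
      ((LinearMap.fst R _ A).comp e'.toLinearMap) ?_
    refine LinearMap.ext fun x => ?_
    simp
  · intro a b hab
    have := congrArg (fun x => x.1.1) hab
    exact hj this
  · intro m
    obtain ⟨x, hx⟩ := hφ (m, 0)
    exact ⟨⟨x, by simp [ψ, hx]⟩, by simp [hx]⟩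
  · rintro ⟨x, hx⟩
    have hx' : (φ x).2 = 0 := hx
    constructor
    · intro h0
      have h0 : (φ x).1 = 0 := h0
      obtain ⟨k, rfl⟩ := (hker x).1 (Prod.ext h0 hx')
      exact ⟨k, rfl⟩
    · rintro ⟨k, hk⟩
      have : (j k, 0) = x := congrArg Subtype.val hk
      have := (hker x).2 ⟨k, this⟩
      simp [this]

/-- Maps into `Q` extend along any kernel once they extend along one projective presentation. -/
lemma extend_of_extend {K0 P0 K P M Q : Type u} [AddCommGroup K0] [Module R K0]
    [AddCommGroup P0] [Module R P0] [AddCommGroup K] [Module R K] [AddCommGroup P] [Module R P]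
    [AddCommGroup M] [Module R M] [AddCommGroup Q] [Module R Q] [Module.Projective R P0]
    (i0 : K0 →ₗ[R] P0) (f0 : P0 →ₗ[R] M) (i : K →ₗ[R] P) (f : P →ₗ[R] M)
    (hf0 : Function.Surjective f0) (h0 : Function.Exact i0 f0)
    (hi : Function.Injective i) (hf : Function.Surjective f) (h : Function.Exact i f)
    (hext : ∀ g : K0 →ₗ[R] Q, ∃ e : P0 →ₗ[R] Q, e.comp i0 = g) (g : K →ₗ[R] Q) :
    ∃ e : P →ₗ[R] Q, e.comp i = g := by
  obtain ⟨w, hw⟩ := Module.projective_lifting_property f f0 hf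
  have hw' : ∀ x, f (w x) = f0 x := LinearMap.congr_fun hw
  let I := LinearEquiv.ofInjective i hi
  have hmem : ∀ x, w (i0 x) ∈ LinearMap.range i := fun x =>
    (h _).1 (by rw [hw', h0.apply_apply_eq_zero])
  let v : K0 →ₗ[R] K := I.symm.toLinearMap.comp (LinearMap.codRestrict _ (w.comp i0) hmem)
  have hv : ∀ x, i (v x) = w (i0 x) := fun x => by
    have := congrArg Subtype.val (I.apply_symm_apply ⟨w (i0 x), hmem x⟩)
    exact this
  obtain ⟨e, he⟩ := hext (g.comp v)
  have he' : ∀ x, e (i0 x) = g (v x) := LinearMap.congr_fun he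
  let s : (K × P0) →ₗ[R] P := i.coprod w
  have hs : Function.Surjective s := by
    intro p
    obtain ⟨p0, hp0⟩ := hf0 (f p)
    obtain ⟨k, hk⟩ := (h (p - w p0)).1 (by rw [map_sub, hw', hp0, sub_self])
    exact ⟨(k, p0), by simp [s, hk]⟩
  let t : (K × P0) →ₗ[R] Q := g.coprod e
  have hst : LinearMap.ker s ≤ LinearMap.ker t := by
    rintro ⟨k, p0⟩ hx
    have hx : i k + w p0 = 0 := by simpa [s] using hx
    have h1 : f0 p0 = 0 := by
      have := congrArg f hx
      simpa [hw', h.apply_apply_eq_zero] using this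
    obtain ⟨k0, rfl⟩ := (h0 _).1 h1
    have : k = - v k0 := hi (by rw [map_neg, hv]; exact eq_neg_of_add_eq_zero_left hx)
    simp [t, he', this]
  refine ⟨((LinearMap.ker s).liftQ t hst).comp
    (s.quotKerEquivOfSurjective hs).symm.toLinearMap, ?_⟩
  ext k
  have : (s.quotKerEquivOfSurjective hs).symm (i k) = Submodule.Quotient.mk (k, 0) := by
    rw [LinearEquiv.symm_apply_eq]
    simp [s]
  simp [this, t]

/-- A short exact sequence `0 → M → P → M → 0` gives a `1`-SG-projective module. -/
lemma one_of_ses {M : Type u} [AddCommGroup M] [Module R M] (P : ModuleCat.{u} R)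
    (i : M →ₗ[R] P) (f : P →ₗ[R] M) (hP : Module.Projective R P)
    (hi : Function.Injective i) (hf : Function.Surjective f) (h : Function.Exact i f)
    (hext : ∀ (Q : ModuleCat.{u} R), Module.Projective R Q →
      ∀ g : M →ₗ[R] Q, ∃ e : P →ₗ[R] Q, e.comp i = g) : IsNSGProjective R 1 M := by
  refine ⟨fun _ => P, fun _ => i.comp f, fun _ => hP, ⟨fun _ => ?_, fun _ => ?_⟩, ?_⟩
  · intro p
    constructor
    · intro hp
      have hp : i (f p) = 0 := hp
      obtain ⟨m, rfl⟩ := (h p).1 (hi (by rw [hp, map_zero]))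
      obtain ⟨q, rfl⟩ := hf m
      exact ⟨q, rfl⟩
    · rintro ⟨q, rfl⟩
      simp [h.apply_apply_eq_zero]
  · refine ⟨(LinearEquiv.ofInjective i hi).trans (LinearEquiv.ofEq _ _ ?_)⟩
    rw [LinearMap.range_comp, LinearMap.range_eq_top.2 hf, Submodule.map_top]
  · intro Q hQ _ g
    constructor
    · intro hg
      have hg : g.comp (i.comp f) = 0 := hg
      have hgi : ∀ m, g (i m) = 0 := fun m => by
        obtain ⟨q, rfl⟩ := hf m
        exact LinearMap.congr_fun hg q
      have hk : LinearMap.ker f ≤ LinearMap.ker g := by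
        intro p hp
        obtain ⟨m, rfl⟩ := (h p).1 hp
        exact hgi m
      obtain ⟨e, he⟩ := hext Q hQ (((LinearMap.ker f).liftQ g hk).comp
        (f.quotKerEquivOfSurjective hf).symm.toLinearMap)
      refine ⟨e, ?_⟩
      ext p
      have h1 := LinearMap.congr_fun he (f p)
      have : (f.quotKerEquivOfSurjective hf).symm (f p) = Submodule.Quotient.mk p := by
        rw [LinearEquiv.symm_apply_eq]
        simp
      simpa [this] using h1
    · rintro ⟨e, rfl⟩
      ext p
      simp [h.apply_apply_eq_zero]

lemma exact_syz (P : ℤ → ModuleCat.{u} R) (d : ∀ i : ℤ, P (i + 1) →ₗ[R] P i)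
    (h : ∀ i : ℤ, Function.Exact (d (i + 1)) (d i)) (i : ℤ) :
    Function.Exact (LinearMap.range (d (i + 1))).subtype (d i).rangeRestrict := by
  intro x
  have h1 := h i x
  rw [← LinearMap.mem_ker, LinearMap.ker_rangeRestrict, LinearMap.mem_ker, h1]
  simp

lemma syz_compare {M : Type u} [AddCommGroup M] [Module R M]
    (P : ℤ → ModuleCat.{u} R) (d : ∀ i : ℤ, P (i + 1) →ₗ[R] P i)
    (P' : ℤ → ModuleCat.{u} R) (d' : ∀ i : ℤ, P' (i + 1) →ₗ[R] P' i)
    (hP : ∀ i, Module.Projective R (P i)) (hP' : ∀ i, Module.Projective R (P' i))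
    (h : ∀ i : ℤ, Function.Exact (d (i + 1)) (d i))
    (h' : ∀ i : ℤ, Function.Exact (d' (i + 1)) (d' i))
    (e : M ≃ₗ[R] LinearMap.range (d 0)) (e' : M ≃ₗ[R] LinearMap.range (d' 0)) (n : ℕ) :
    ∀ j : ℤ, j = n → ∃ A B : ModuleCat.{u} R, Module.Projective R A ∧ Module.Projective R B ∧
      Nonempty ((LinearMap.range (d j) × A) ≃ₗ[R] (LinearMap.range (d' j) × B)) := by
  induction n with
  | zero =>
    rintro j hj
    obtain rfl : j = 0 := by simpa using hj
    exact ⟨ModuleCat.of R PUnit, ModuleCat.of R PUnit,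
      inferInstanceAs (Module.Projective R PUnit.{u + 1}), inferInstanceAs (Module.Projective R PUnit.{u + 1}),
      ⟨(e.symm.trans e').prodCongr (LinearEquiv.refl R _)⟩⟩
  | succ n ih =>
    rintro j hj
    obtain rfl : j = (n : ℤ) + 1 := by simpa using hj
    obtain ⟨A, B, hA, hB, ⟨ε⟩⟩ := ih n rfl
    have := hP (n + 1)
    have := hP' (n + 1)
    refine ⟨ModuleCat.of R (P' (n + 1) × B), ModuleCat.of R (P (n + 1) × A),
      inferInstanceAs (Module.Projective R (P' (n + 1) × B)),
      inferInstanceAs (Module.Projective R (P (n + 1) × A)), ?_⟩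
    exact schanuel_step _ _ _ _ (Submodule.subtype_injective _) (d n).surjective_rangeRestrict
      (exact_syz P d h n) (Submodule.subtype_injective _) (d' n).surjective_rangeRestrict
      (exact_syz P' d' h' n) ε

end Helpers

/-- A module that is both `n`- and `(n+1)`-strongly Gorenstein projective is
`1`-strongly Gorenstein projective. -/
theorem oneSGProjective_of_nSGProjective_succ (R : Type u) [Ring R] (n : ℕ) (hn : 0 < n)
    (M : Type u) [AddCommGroup M] [Module R M]
    (h1 : IsNSGProjective R n M) (h2 : IsNSGProjective R (n + 1) M) :
    IsNSGProjective R 1 M := by 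
  obtain ⟨P, d, hP, ⟨hex, hper⟩, hhom⟩ := h1
  obtain ⟨P', d', hP', ⟨hex', hper'⟩, -⟩ := h2
  have key : ∀ k j : ℤ, j = n * k → Nonempty (M ≃ₗ[R] LinearMap.range (d j)) := by
    rintro k _ rfl
    exact hper k
  have key' : ∀ k j : ℤ, j = (n + 1 : ℕ) * k → Nonempty (M ≃ₗ[R] LinearMap.range (d' j)) := by
    rintro k _ rfl
    exact hper' k
  obtain ⟨e0⟩ := key 0 0 (by simp)
  obtain ⟨en⟩ := key 1 n (by simp)
  obtain ⟨e0'⟩ := key' 0 0 (by simp)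
  obtain ⟨en'⟩ := key' 1 (n + 1) (by simp)
  obtain ⟨A, B, hA, hB, ⟨ε⟩⟩ := syz_compare P d P' d' hP hP' hex hex' e0 e0' n n rfl
  have := hP' (n + 1)
  obtain ⟨X, i, f, hX, hi, hf, hexX⟩ := cut_down
    ((LinearMap.range (d' (n + 1))).subtype.comp en'.toLinearMap) (d' n).rangeRestrict
    ((Submodule.subtype_injective _).comp en'.injective) (d' n).surjective_rangeRestrict
    (by
      intro x
      rw [exact_syz P' d' hex' n x]
      constructor
      · rintro ⟨y, rfl⟩
        exact ⟨en'.symm y, by simp⟩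
      · rintro ⟨y, rfl⟩
        exact ⟨en' y, rfl⟩)
    ((en.prodCongr (LinearEquiv.refl R A)).trans ε)
  refine one_of_ses X i f hX hi hf hexX ?_
  intro Q hQ g
  have := hP (0 + 1)
  refine extend_of_extend (LinearMap.range (d (0 + 1))).subtype
    (e0.symm.toLinearMap.comp (d 0).rangeRestrict) i f
    (e0.symm.surjective.comp (d 0).surjective_rangeRestrict) ?_ hi hf hexX ?_ g
  · intro x
    rw [← exact_syz P d hex 0 x]
    simp only [LinearMap.comp_apply, LinearEquiv.coe_coe, LinearEquiv.map_eq_zero_iff]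
  · intro g
    have hz : (g.comp (d (0 + 1)).rangeRestrict).comp (d (0 + 1 + 1)) = 0 := by
      ext x
      have : (d (0 + 1)).rangeRestrict (d (0 + 1 + 1) x) = 0 :=
        Subtype.ext ((hex (0 + 1)).apply_apply_eq_zero x)
      rw [LinearMap.comp_apply, LinearMap.comp_apply, this, map_zero, LinearMap.zero_apply]
    obtain ⟨e, he⟩ := (hhom Q hQ (0 + 1) _).1 hz
    refine ⟨e, ?_⟩
    ext ⟨_, y, rfl⟩
    exact LinearMap.congr_fun he y
end

section
/- A module M is n-strongly Gorenstein projective if and only if there exists an exact sequence 0 → M →^{f_n} P_{n−1} → ⋯ → P₀ →^{f_0} M → 0 in which each P_i has finite projective dimension, such that ⊕_{i=1}^{n} Im(f_i) is Gorenstein projective. -/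
open CategoryTheory DirectSum

universe u

section Helpers

variable {R : Type u} [Ring R]

/-- A short exact sequence `0 → A → E → C → 0` with `E` projective such that every map from `A`
to a projective extends to `E`. -/
def TLink (A C : ModuleCat.{u} R) : Prop :=
  ∃ (E : ModuleCat.{u} R) (f : A →ₗ[R] E) (g : E →ₗ[R] C), Module.Projective R E ∧
    Function.Injective f ∧ Function.Surjective g ∧ Function.Exact f g ∧
    ∀ (Q : ModuleCat.{u} R), Module.Projective R Q → ∀ h : A →ₗ[R] Q,
      ∃ h' : E →ₗ[R] Q, h'.comp f = h

theorem TLink.congr_left {A A' C : ModuleCat.{u} R} (e : A' ≃ₗ[R] A) (h : TLink A C) :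
    TLink A' C := by
  obtain ⟨E, f, g, hE, hf, hg, hfg, hQ⟩ := h
  refine ⟨E, f.comp e.toLinearMap, g, hE, hf.comp e.injective, hg, ?_, ?_⟩
  · intro x
    rw [hfg x]
    constructor
    · rintro ⟨a, rfl⟩
      exact ⟨e.symm a, by simp⟩
    · rintro ⟨a, rfl⟩
      exact ⟨e a, by simp⟩
  · intro Q hQp h
    obtain ⟨h', hh'⟩ := hQ Q hQp (h.comp e.symm.toLinearMap)
    refine ⟨h', ?_⟩
    ext x
    have := LinearMap.congr_fun hh' (e x)
    simpa using this

theorem TLink.directSum {n : ℕ} {A C : Fin n → ModuleCat.{u} R} (h : ∀ k, TLink (A k) (C k)) :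
    TLink (ModuleCat.of R (⨁ k, A k)) (ModuleCat.of R (⨁ k, C k)) := by
  choose E f g hE hf hg hfg hQ using h
  refine ⟨ModuleCat.of R (⨁ k, E k), DirectSum.lmap f, DirectSum.lmap g, ?_, ?_, ?_, ?_, ?_⟩
  · exact Module.Projective.directSum
  · exact (DirectSum.lmap_injective f).2 hf
  · exact (DirectSum.lmap_surjective g).2 hg
  · intro x
    constructor
    · intro hx
      have h1 : ∀ k, ∃ a, f k a = x k := fun k => (hfg k (x k)).1 (by
        rw [← DirectSum.lmap_apply g x k, hx]; rfl)
      choose a ha using h1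
      refine ⟨(DirectSum.linearEquivFunOnFintype R (Fin n) (fun k => A k)).symm a, ?_⟩
      apply DFinsupp.ext
      intro k
      exact ha k
    · rintro ⟨a, rfl⟩
      apply DFinsupp.ext
      intro k
      exact (hfg k _).2 ⟨a k, rfl⟩
  · intro Q hQp h
    choose h' hh' using fun k => hQ k Q hQp (h.comp (DirectSum.lof R (Fin n) (fun k => A k) k))
    refine ⟨DirectSum.toModule R (Fin n) Q h', ?_⟩
    apply DirectSum.linearMap_ext
    intro k
    ext x
    have := LinearMap.congr_fun (hh' k) x
    simpa [DirectSum.toModule_lof] using this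

theorem tlink_of_complex (P : ℤ → ModuleCat.{u} R) (d : ∀ i : ℤ, P (i + 1) →ₗ[R] P i)
    (hP : ∀ i, Module.Projective R (P i)) (hex : ∀ i : ℤ, Function.Exact (d (i + 1)) (d i))
    (hh : IsHomExact R P d) (i : ℤ) :
    TLink (ModuleCat.of R (LinearMap.range (d (i + 1)))) (ModuleCat.of R (LinearMap.range (d i))) := by
  refine ⟨P (i + 1), (LinearMap.range (d (i + 1))).subtype, (d i).rangeRestrict, hP _,
    Subtype.val_injective, LinearMap.surjective_rangeRestrict _, ?_, ?_⟩
  · intro x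
    have := hex i x
    constructor
    · intro hx
      obtain ⟨y, hy⟩ := this.1 (congrArg Subtype.val hx)
      exact ⟨⟨x, y, hy⟩, rfl⟩
    · rintro ⟨⟨y, hy⟩, rfl⟩
      exact Subtype.ext (this.2 hy)
  · intro Q hQ h
    have h0 := (hh Q hQ (i + 1)) (h.comp (d (i + 1)).rangeRestrict)
    obtain ⟨g, hg⟩ := h0.1 (by
      ext x
      have : (d (i + 1)).rangeRestrict (d (i + 1 + 1) x) = 0 :=
        Subtype.ext ((hex (i + 1) _).2 ⟨x, rfl⟩)
      have h2 : h ((d (i + 1)).rangeRestrict (d (i + 1 + 1) x)) = 0 := by rw [this, map_zero]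
      exact h2)
    refine ⟨g, ?_⟩
    ext ⟨y, x, rfl⟩
    exact LinearMap.congr_fun hg x

theorem splice (X : ℤ → ModuleCat.{u} R) (h : ∀ j, TLink (X j) (X (j - 1))) :
    ∃ (P : ℤ → ModuleCat.{u} R) (d : ∀ i : ℤ, P (i + 1) →ₗ[R] P i),
      (∀ i, Module.Projective R (P i)) ∧ (∀ i : ℤ, Function.Exact (d (i + 1)) (d i)) ∧
      IsHomExact R P d ∧ ∀ i, Nonempty (X i ≃ₗ[R] LinearMap.range (d i)) := by
  choose P f g0 hP hf hg0 hfg0 hQ using h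
  have hg1 : ∀ i, ∃ g : P (i + 1) →ₗ[R] X i, Function.Surjective g ∧
      Function.Exact (f (i + 1)) g := by
    intro i
    have : ∀ k, k = i → ∀ g : P (i + 1) →ₗ[R] X k, Function.Surjective g →
        Function.Exact (f (i + 1)) g → ∃ g : P (i + 1) →ₗ[R] X i, Function.Surjective g ∧
        Function.Exact (f (i + 1)) g := by
      rintro k rfl g h1 h2
      exact ⟨g, h1, h2⟩
    exact this _ (by ring) (g0 (i + 1)) (hg0 _) (hfg0 _)
  choose g hg hfg using hg1
  have hker : ∀ i x, (f i).comp (g i) x = 0 ↔ g i x = 0 := fun i x => by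
    rw [LinearMap.comp_apply, map_eq_zero_iff _ (hf i)]
  have hex : ∀ i, Function.Exact ((f (i + 1)).comp (g (i + 1))) ((f i).comp (g i)) := by
    intro i x
    rw [hker, hfg i x]
    constructor
    · rintro ⟨y, rfl⟩
      obtain ⟨z, rfl⟩ := hg (i + 1) y
      exact ⟨z, rfl⟩
    · rintro ⟨z, rfl⟩
      exact ⟨g (i + 1) z, rfl⟩
  refine ⟨P, fun i => (f i).comp (g i), hP, hex, ?_, ?_⟩
  · intro Q hQp i u
    constructor
    · intro hu
      have hu' : ∀ x, g i x = 0 → u x = 0 := by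
        intro x hx
        obtain ⟨z, rfl⟩ := (hex i x).1 ((hker i x).2 hx)
        exact LinearMap.congr_fun hu z
      let e := (g i).quotKerEquivOfSurjective (hg i)
      have hk : LinearMap.ker (g i) ≤ LinearMap.ker u := fun x hx => hu' x hx
      let v : X i →ₗ[R] Q := ((LinearMap.ker (g i)).liftQ u hk).comp
        e.symm.toLinearMap
      obtain ⟨w, hw⟩ := hQ i Q hQp v
      refine ⟨w, ?_⟩
      ext x
      have h1 := LinearMap.congr_fun hw (g i x)
      have h2 : e.symm (g i x) = Submodule.Quotient.mk x := by
        rw [LinearEquiv.symm_apply_eq]; rfl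
      have h3 : v (g i x) = u x := by
        change (LinearMap.ker (g i)).liftQ u hk (e.symm (g i x)) = u x
        rw [h2]; rfl
      exact h1.trans h3
    · rintro ⟨w, rfl⟩
      ext x
      have : ((f i).comp (g i)) (((f (i + 1)).comp (g (i + 1))) x) = 0 := (hex i _).2 ⟨x, rfl⟩
      change w (((f i).comp (g i)) (((f (i + 1)).comp (g (i + 1))) x)) = 0
      rw [this, map_zero]
  · intro i
    have hr : LinearMap.range (f i) = LinearMap.range ((f i).comp (g i)) := by
      rw [LinearMap.range_comp_of_range_eq_top _ (LinearMap.range_eq_top.2 (hg i))]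
    exact ⟨(LinearEquiv.ofInjective (f i) (hf i)).trans (LinearEquiv.ofEq _ _ hr)⟩

open CategoryTheory.Abelian

/-- All higher `Ext` groups into projectives vanish. -/
def Perp (G : ModuleCat.{u} R) : Prop :=
  ∀ (Q : ModuleCat.{u} R), Module.Projective R Q → ∀ (k : ℕ) (x : Ext G Q (k + 1)), x = 0

theorem ses_shortExact {A E C : ModuleCat.{u} R} (f : A →ₗ[R] E) (g : E →ₗ[R] C)
    (hf : Function.Injective f) (hg : Function.Surjective g) (hfg : Function.Exact f g) :
    (ShortComplex.mk (ModuleCat.ofHom f) (ModuleCat.ofHom g) (by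
      ext x; exact hfg.apply_apply_eq_zero x)).ShortExact :=
  { exact := (ShortComplex.ShortExact.moduleCat_exact_iff_function_exact _).mpr hfg
    mono_f := (ModuleCat.mono_iff_injective _).2 hf
    epi_g := (ModuleCat.epi_iff_surjective _).2 hg }

theorem Perp.retract {A B : ModuleCat.{u} R} (i : A →ₗ[R] B) (p : B →ₗ[R] A)
    (hip : p.comp i = LinearMap.id) (hB : Perp B) : Perp A := by
  intro Q hQ k x
  have h1 : (Ext.mk₀ (ModuleCat.ofHom p)).comp x (zero_add _) = 0 := hB Q hQ k _
  have h2 : ModuleCat.ofHom i ≫ ModuleCat.ofHom p = 𝟙 A := by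
    rw [← ModuleCat.ofHom_comp, hip]; rfl
  rw [← Ext.mk₀_id_comp x, ← h2, ← Ext.mk₀_comp_mk₀_assoc, h1, Ext.comp_zero]

theorem Perp.middle {A E C : ModuleCat.{u} R} (f : A →ₗ[R] E) (g : E →ₗ[R] C)
    (hf : Function.Injective f) (hg : Function.Surjective g) (hfg : Function.Exact f g)
    (hA : Perp A) (hC : Perp C) : Perp E := by
  intro Q hQ k x
  obtain ⟨y, rfl⟩ := Ext.contravariant_sequence_exact₂ (ses_shortExact f g hf hg hfg) Q x
    (hA Q hQ k _)
  rw [hC Q hQ k y, Ext.comp_zero]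

theorem Perp.extend {A E C : ModuleCat.{u} R} (f : A →ₗ[R] E) (g : E →ₗ[R] C)
    (hf : Function.Injective f) (hg : Function.Surjective g) (hfg : Function.Exact f g)
    (Q : ModuleCat.{u} R) (hx : ∀ x : Ext C Q 1, x = 0) (h : A →ₗ[R] Q) :
    ∃ h' : E →ₗ[R] Q, h'.comp f = h := by
  obtain ⟨y, hy⟩ := Ext.contravariant_sequence_exact₁ (ses_shortExact f g hf hg hfg) Q
    (Ext.mk₀ (ModuleCat.ofHom h)) (by rfl) (hx _)
  obtain ⟨y, rfl⟩ := (Ext.mk₀_bijective _ _).2 y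
  rw [Ext.mk₀_comp_mk₀] at hy
  have := (Ext.mk₀_bijective _ _).1 hy
  exact ⟨y.hom, by simpa using congrArg ModuleCat.Hom.hom this⟩

theorem Perp.of_links (X : ℕ → ModuleCat.{u} R) (h : ∀ i, TLink (X (i + 1)) (X i)) (i : ℕ) :
    Perp (X i) := by
  intro Q hQ k
  induction k generalizing i with
  | zero =>
    intro x
    obtain ⟨E, f, g, hE, hf, hg, hfg, hQ'⟩ := h i
    have hS := ses_shortExact f g hf hg hfg
    obtain ⟨y, rfl⟩ := Ext.contravariant_sequence_exact₃ hS Q x (Ext.eq_zero_of_projective _)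
      (n₀ := 0) (by rfl)
    obtain ⟨y, rfl⟩ := (Ext.mk₀_bijective _ _).2 y
    obtain ⟨z, hz⟩ := hQ' Q hQ y.hom
    have : y = ModuleCat.ofHom f ≫ ModuleCat.ofHom z :=
      ModuleCat.hom_ext hz.symm
    rw [this, ← Ext.mk₀_comp_mk₀]
    exact hS.extClass_comp_assoc _
  | succ k ih =>
    intro x
    obtain ⟨E, f, g, hE, hf, hg, hfg, hQ'⟩ := h i
    have hS := ses_shortExact f g hf hg hfg
    obtain ⟨y, rfl⟩ := Ext.contravariant_sequence_exact₃ hS Q x (Ext.eq_zero_of_projective _)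
      (n₀ := k + 1) (by ring)
    rw [ih (i + 1) y, Ext.comp_zero]

theorem IsGProjective.perp {G : Type u} [AddCommGroup G] [Module R G] (h : IsGProjective R G) :
    Perp (ModuleCat.of R G) := by
  obtain ⟨P, d, hP, hex, hh, ⟨e⟩⟩ := h
  have h1 : Perp (ModuleCat.of R (LinearMap.range (d ((0 : ℕ) : ℤ)))) :=
    Perp.of_links (fun i : ℕ => ModuleCat.of R (LinearMap.range (d (i : ℤ))))
      (fun i => tlink_of_complex P d hP hex hh i) 0
  exact Perp.retract (B := ModuleCat.of R (LinearMap.range (d 0))) e.toLinearMap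
    e.symm.toLinearMap (by ext; simp) h1

theorem ker_exact {E F : ModuleCat.{u} R} (f : E →ₗ[R] F) :
    Function.Exact (LinearMap.ker f).subtype f := by
  intro x
  constructor
  · intro hx
    exact ⟨⟨x, hx⟩, rfl⟩
  · rintro ⟨y, rfl⟩
    exact y.2

theorem Perp.ext_projDimLE {E : ModuleCat.{u} R} (hE : Perp E) (m : ℕ) :
    ∀ (K : ModuleCat.{u} R), projDimLE R m K → ∀ (k : ℕ) (x : Ext E K (k + 1)), x = 0 := by
  induction m with
  | zero => exact fun K hK => hE K hK
  | succ m ih =>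
    rintro K ⟨F, f, hF, hf, hK⟩ k x
    have hS := ses_shortExact (A := ModuleCat.of R (LinearMap.ker f)) (LinearMap.ker f).subtype f
      Subtype.val_injective hf (ker_exact f)
    obtain ⟨y, rfl⟩ := Ext.covariant_sequence_exact₃ E hS x rfl (ih _ hK _ _)
    rw [hE F hF k y, Ext.zero_comp]

theorem Perp.projective {E : ModuleCat.{u} R} (hE : Perp E) (m : ℕ) (h : projDimLE R m E) :
    Module.Projective R E := by
  cases m with
  | zero => exact h
  | succ m =>
    obtain ⟨F, f, hF, hf, hK⟩ := h
    obtain ⟨r, hr⟩ := Perp.extend (A := ModuleCat.of R (LinearMap.ker f))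
      (LinearMap.ker f).subtype f
      Subtype.val_injective hf (ker_exact f) (ModuleCat.of R (LinearMap.ker f))
      (hE.ext_projDimLE m _ hK 0) LinearMap.id
    have h10 : (∃ l, l ∘ₗ (LinearMap.ker f).subtype = LinearMap.id) →
        ∃ l, f ∘ₗ l = LinearMap.id :=
      (((ker_exact f).split_tfae Subtype.val_injective hf).out 1 0).1
    obtain ⟨s, hs⟩ := h10 ⟨r, hr⟩
    exact Module.Projective.of_split s f hs

theorem tlink_of_perp {A E C : ModuleCat.{u} R} (f : A →ₗ[R] E) (g : E →ₗ[R] C)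
    (hf : Function.Injective f) (hg : Function.Surjective g) (hfg : Function.Exact f g)
    (hA : Perp A) (hC : Perp C) (hE : ∃ m, projDimLE R m E) : TLink A C := by
  obtain ⟨m, hm⟩ := hE
  exact ⟨E, f, g, (hA.middle f g hf hg hfg hC).projective m hm, hf, hg, hfg,
    fun Q hQ h => Perp.extend f g hf hg hfg Q (hC Q hQ 0) h⟩

end Helpers

/-- `M` is `n`-strongly Gorenstein projective iff there is an exact sequence
`0 → M → P_{n-1} → ⋯ → P_0 → M → 0` in which each `P i` has finite projective
dimension, such that the direct sum of the images is Gorenstein projective. -/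
theorem nSGProjective_iff_syzygies_gProjective (R : Type u) [Ring R] (n : ℕ)
    (hn : 0 < n) (M : Type u) [AddCommGroup M] [Module R M] :
    IsNSGProjective R n M ↔
      ∃ (P : ℤ → ModuleCat.{u} R) (d : ∀ i : ℤ, P (i + 1) →ₗ[R] P i),
        (∀ i, ∃ m : ℕ, projDimLE R m (P i)) ∧ IsPeriodicExact R n M P d ∧
        IsGProjective R (⨁ i : Fin n, LinearMap.range (d ((i : ℕ) : ℤ))) := by
  constructor
  · rintro ⟨P, d, hP, hper, hh⟩
    refine ⟨P, d, fun i => ⟨0, hP i⟩, hper, ?_⟩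
    have hl : ∀ j : ℤ, TLink (ModuleCat.of R (LinearMap.range (d j)))
        (ModuleCat.of R (LinearMap.range (d (j - 1)))) := by
      intro j
      obtain ⟨i, rfl⟩ : ∃ i, j = i + 1 := ⟨j - 1, by ring⟩
      have := tlink_of_complex P d hP hper.1 hh i
      rwa [show i + 1 - 1 = i by ring]
    obtain ⟨P', d', hP', hex', hh', he⟩ := splice
      (fun j : ℤ => ModuleCat.of R (⨁ k : Fin n, LinearMap.range (d ((k : ℕ) + j))))
      (fun j => TLink.directSum
        (A := fun k : Fin n => ModuleCat.of R (LinearMap.range (d ((k : ℕ) + j))))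
        (C := fun k : Fin n => ModuleCat.of R (LinearMap.range (d ((k : ℕ) + (j - 1)))))
        (fun k => by
          have := hl ((k : ℕ) + j)
          rwa [show ((k : ℕ) : ℤ) + j - 1 = (k : ℕ) + (j - 1) by ring] at this))
    have h0 := he 0
    have key : ∀ c : Fin n → ℤ, c = (fun k : Fin n => ((k : ℕ) : ℤ)) →
        Nonempty ((⨁ k : Fin n, LinearMap.range (d (c k))) ≃ₗ[R] LinearMap.range (d' 0)) →
        IsGProjective R (⨁ i : Fin n, LinearMap.range (d ((i : ℕ) : ℤ))) := by
      rintro _ rfl h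
      exact ⟨P', d', hP', hex', hh', h⟩
    exact key (fun k => ((k : ℕ) : ℤ) + 0) (by funext k; ring) h0
  · rintro ⟨P, d, hpd, ⟨hex, hM⟩, hG⟩
    have hperp := hG.perp
    have hZ : ∀ r : ℕ, r < n → Perp (ModuleCat.of R (LinearMap.range (d (r : ℤ)))) := by
      intro r hr
      exact Perp.retract (A := ModuleCat.of R (LinearMap.range (d (r : ℤ))))
        (B := ModuleCat.of R (⨁ i : Fin n, LinearMap.range (d ((i : ℕ) : ℤ))))
        (DirectSum.lof R (Fin n) (fun i : Fin n => LinearMap.range (d ((i : ℕ) : ℤ))) ⟨r, hr⟩)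
        (DirectSum.component R (Fin n) (fun i : Fin n => LinearMap.range (d ((i : ℕ) : ℤ))) ⟨r, hr⟩)
        (DirectSum.component_comp_lof_same R
          (M := fun i : Fin n => LinearMap.range (d ((i : ℕ) : ℤ))) ⟨r, hr⟩) hperp
    obtain ⟨e0⟩ := hM 0
    obtain ⟨e1⟩ := hM 1
    rw [mul_zero] at e0
    rw [mul_one] at e1
    have hZn : Perp (ModuleCat.of R (LinearMap.range (d (n : ℤ)))) :=
      Perp.retract (B := ModuleCat.of R (LinearMap.range (d ((0 : ℕ) : ℤ))))
        (e1.symm.trans e0).toLinearMap (e1.symm.trans e0).symm.toLinearMap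
        (by ext; simp) (hZ 0 hn)
    have hZ' : ∀ r : ℕ, r ≤ n → Perp (ModuleCat.of R (LinearMap.range (d (r : ℤ)))) := by
      intro r hr
      rcases hr.lt_or_eq with h | rfl
      · exact hZ r h
      · exact hZn
    have hl : ∀ r : ℕ, r < n → TLink (ModuleCat.of R (LinearMap.range (d ((r : ℤ) + 1))))
        (ModuleCat.of R (LinearMap.range (d (r : ℤ)))) := by
      intro r hr
      refine tlink_of_perp (E := P ((r : ℤ) + 1)) (LinearMap.range (d ((r : ℤ) + 1))).subtype
        (d (r : ℤ)).rangeRestrict Subtype.val_injective (LinearMap.surjective_rangeRestrict _) ?_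
        (by simpa using hZ' (r + 1) hr) (hZ r hr) (hpd _)
      intro x
      have := hex r x
      constructor
      · intro hx
        obtain ⟨y, hy⟩ := this.1 (congrArg Subtype.val hx)
        exact ⟨⟨x, y, hy⟩, rfl⟩
      · rintro ⟨⟨y, hy⟩, rfl⟩
        exact Subtype.ext (this.2 hy)
    have hn' : (0 : ℤ) < n := by exact_mod_cast hn
    obtain ⟨P', d', hP', hex', hh', he⟩ := splice
      (fun j : ℤ => ModuleCat.of R (LinearMap.range (d (j % n)))) (by
        intro j
        obtain ⟨r, hr⟩ := Int.eq_ofNat_of_zero_le (Int.emod_nonneg (j - 1) hn'.ne')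
        have hrn : r < n := by
          have := Int.emod_lt_of_pos (j - 1) hn'
          omega
        have hlr := hl r hrn
        have hj : j % n = ((r : ℤ) + 1) % n := by
          rw [← hr, Int.emod_add_emod, sub_add_cancel]
        change TLink (ModuleCat.of R (LinearMap.range (d (j % n))))
          (ModuleCat.of R (LinearMap.range (d ((j - 1) % n))))
        rw [hr, hj]
        by_cases hlt : r + 1 < n
        · rw [Int.emod_eq_of_lt (by omega) (by omega)]
          exact hlr
        · have hrn' : (r : ℤ) + 1 = n := by omega
          have hr0 : ((r : ℤ) + 1) % n = 0 := by rw [hrn', Int.emod_self]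
          obtain ⟨e2⟩ : Nonempty (M ≃ₗ[R] LinearMap.range (d ((r : ℤ) + 1))) := by
            rw [hrn']
            exact ⟨e1⟩
          rw [hr0]
          exact hlr.congr_left (A' := ModuleCat.of R (LinearMap.range (d 0))) (e0.symm.trans e2))
    refine ⟨P', d', hP', ⟨hex', ?_⟩, hh'⟩
    intro k
    obtain ⟨e⟩ := he (n * k)
    rw [Int.mul_emod_right] at e
    exact ⟨e0.trans e⟩
end

section
/- A finitely generated module M over a ring R is n-strongly Gorenstein projective if and only if there exists an exact sequence 0 → M → P_{n−1} → ⋯ → P₀ → M → 0 of finitely generated modules with each P_i projective and Ext^i_R(M, R) = 0 for all i ≥ 1. -/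
open CategoryTheory DirectSum

universe u

namespace NSGAux

/-- Vanishing of the (derived category) Ext group. -/
abbrev V (R : Type u) [Ring R] (A Y : Type u) [AddCommGroup A] [Module R A]
    [AddCommGroup Y] [Module R Y] (i : ℕ) : Prop :=
  Subsingleton (Abelian.Ext (ModuleCat.of R A) (ModuleCat.of R Y) i)

lemma old_iff_new (R : Type u) [Ring R] (X Y : ModuleCat.{u} R) (i : ℕ) :
    Subsingleton (((Ext ℤ (ModuleCat.{u} R) (i + 1)).obj (Opposite.op X)).obj Y) ↔
      Subsingleton (Abelian.Ext X Y (i + 1)) := by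
  let P : ProjectiveResolution X := ProjectiveResolution.of X
  have h1 : Subsingleton (((Ext ℤ (ModuleCat.{u} R) (i + 1)).obj (Opposite.op X)).obj Y) ↔
      ∀ f : P.complex.X (i + 1) ⟶ Y, P.complex.d (i + 2) (i + 1) ≫ f = 0 →
        ∃ g : P.complex.X i ⟶ Y, P.complex.d (i + 1) i ≫ g = f := by
    rw [← ModuleCat.isZero_iff_subsingleton, (P.isoExt (R := ℤ) (i + 1) Y).isZero_iff,
      ← HomologicalComplex.exactAt_iff_isZero_homology,
      HomologicalComplex.exactAt_iff' _ i (i + 1) (i + 2) (by simp) (by simp),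
      ShortComplex.moduleCat_exact_iff]
    rfl
  rw [h1]
  constructor
  · intro h
    refine subsingleton_of_forall_eq 0 fun α => ?_
    obtain ⟨f, hf, rfl⟩ := P.extMk_surjective α (i + 2) rfl
    rw [P.extMk_eq_zero_iff _ _ _ _ i rfl]
    exact h f hf
  · intro h f hf
    rw [← P.extMk_eq_zero_iff f (i + 2) rfl hf i rfl]
    exact Subsingleton.elim _ _

section
variable {R : Type u} [Ring R] {A B C Y : Type u} [AddCommGroup A] [Module R A]
    [AddCommGroup B] [Module R B] [AddCommGroup C] [Module R C] [AddCommGroup Y] [Module R Y]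
    {f : A →ₗ[R] B} {g : B →ₗ[R] C}

/-- The short complex. -/
noncomputable abbrev sc (f : A →ₗ[R] B) (g : B →ₗ[R] C) (h : Function.Exact f g) :
    ShortComplex (ModuleCat.{u} R) :=
  ShortComplex.mk (ModuleCat.ofHom f) (ModuleCat.ofHom g)
    (by ext x; exact h.apply_apply_eq_zero x)

lemma sc_exact (hf : Function.Injective f) (h : Function.Exact f g)
    (hg : Function.Surjective g) : (sc f g h).ShortExact :=
  ModuleCat.shortComplex_shortExact _ h hf hg

lemma extend_of_V (hf : Function.Injective f) (h : Function.Exact f g)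
    (hg : Function.Surjective g) (hV : V R C Y 1) (a : A →ₗ[R] Y) :
    ∃ b : B →ₗ[R] Y, b.comp f = a := by
  obtain ⟨x, hx⟩ := Abelian.Ext.contravariant_sequence_exact₁ (sc_exact hf h hg)
    (ModuleCat.of R Y) (Abelian.Ext.mk₀ (ModuleCat.ofHom a)) (n₁ := 1) rfl (hV.elim _ _)
  obtain ⟨b, rfl⟩ := (Abelian.Ext.mk₀_bijective _ _).2 x
  rw [Abelian.Ext.mk₀_comp_mk₀] at hx
  have := (Abelian.Ext.mk₀_bijective _ _).1 hx
  refine ⟨b.hom, ?_⟩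
  exact congrArg ModuleCat.Hom.hom this

lemma V_of_extend (hf : Function.Injective f) (h : Function.Exact f g)
    (hg : Function.Surjective g) [Module.Projective R B]
    (H : ∀ a : A →ₗ[R] Y, ∃ b : B →ₗ[R] Y, b.comp f = a) : V R C Y 1 := by
  have : Projective (ModuleCat.of R B) := (IsProjective.iff_projective B).1 inferInstance
  refine subsingleton_of_forall_eq 0 fun x => ?_
  obtain ⟨y, hy⟩ := Abelian.Ext.contravariant_sequence_exact₃ (sc_exact hf h hg)
    (ModuleCat.of R Y) x (Abelian.Ext.eq_zero_of_projective _) (n₀ := 0) rfl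
  obtain ⟨a, rfl⟩ := (Abelian.Ext.mk₀_bijective _ _).2 y
  obtain ⟨b, hb⟩ := H a.hom
  have e : (sc f g h).f ≫ ModuleCat.ofHom b = a := by
    ext x; exact LinearMap.congr_fun hb x
  rw [← hy, ← e, ← Abelian.Ext.mk₀_comp_mk₀]
  exact (sc_exact hf h hg).extClass_comp_assoc _

lemma V_shift (hf : Function.Injective f) (h : Function.Exact f g)
    (hg : Function.Surjective g) [Module.Projective R B] (i : ℕ) :
    V R A Y (i + 1) ↔ V R C Y (i + 2) := by
  have : Projective (ModuleCat.of R B) := (IsProjective.iff_projective B).1 inferInstance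
  constructor
  · intro hV
    refine subsingleton_of_forall_eq 0 fun x => ?_
    obtain ⟨y, hy⟩ := Abelian.Ext.contravariant_sequence_exact₃ (sc_exact hf h hg)
      (ModuleCat.of R Y) x (Abelian.Ext.eq_zero_of_projective _) (n₀ := i + 1) (by omega)
    rw [← hy, hV.elim y 0, Abelian.Ext.comp_zero]
  · intro hV
    refine subsingleton_of_forall_eq 0 fun x => ?_
    obtain ⟨y, hy⟩ := Abelian.Ext.contravariant_sequence_exact₁ (sc_exact hf h hg)
      (ModuleCat.of R Y) x (n₁ := i + 2) (by omega) (hV.elim _ _)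
    rw [← hy, Abelian.Ext.eq_zero_of_projective y, Abelian.Ext.comp_zero]

lemma V_iso (e : A ≃ₗ[R] B) (i : ℕ) (hV : V R A Y i) : V R B Y i := by
  refine subsingleton_of_forall_eq 0 fun x => ?_
  have : (Abelian.Ext.mk₀ (ModuleCat.ofHom e.symm.toLinearMap)).comp
      ((Abelian.Ext.mk₀ (ModuleCat.ofHom e.toLinearMap)).comp x (zero_add i)) (zero_add i) = x := by
    rw [Abelian.Ext.mk₀_comp_mk₀_assoc, ← ModuleCat.ofHom_comp]
    simp
  rw [← this, hV.elim (Abelian.Ext.comp _ x _) 0, Abelian.Ext.comp_zero]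

end

end NSGAux

namespace NSGAux

section
variable (R : Type u) [Ring R]

/-- `B` is a quotient of a projective by `A`. -/
def PSes (A B : ModuleCat.{u} R) : Prop :=
  ∃ (P : ModuleCat.{u} R) (f : A →ₗ[R] P) (g : P →ₗ[R] B), Module.Projective R P ∧
    Function.Injective f ∧ Function.Exact f g ∧ Function.Surjective g

/-- `B` is a quotient of a finitely generated projective by `A`. -/
def FSes (A B : ModuleCat.{u} R) : Prop :=
  ∃ (P : ModuleCat.{u} R) (f : A →ₗ[R] P) (g : P →ₗ[R] B), Module.Projective R P ∧
    Module.Finite R P ∧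
    Function.Injective f ∧ Function.Exact f g ∧ Function.Surjective g

variable {R}

lemma PSes.toFSes {A B : ModuleCat.{u} R} (h : PSes R A B) (hA : Module.Finite R A)
    (hB : Module.Finite R B) : FSes R A B := by
  obtain ⟨P, f, g, hP, hf, h, hg⟩ := h
  refine ⟨P, f, g, hP, ?_, hf, h, hg⟩
  have e : LinearMap.ker g = LinearMap.range f := LinearMap.exact_iff.1 h
  refine ⟨Submodule.fg_of_fg_map_of_fg_inf_ker g ?_ ?_⟩
  · rw [Submodule.map_top, LinearMap.range_eq_top.2 hg]
    exact hB.1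
  · rw [top_inf_eq, e, LinearMap.range_eq_map]
    exact hA.1.map f

lemma PSes.congr_left {A A' B : ModuleCat.{u} R} (h : PSes R A B) (e : A' ≃ₗ[R] A) :
    PSes R A' B := by
  obtain ⟨P, f, g, hP, hf, h, hg⟩ := h
  refine ⟨P, f.comp e.toLinearMap, g, hP, hf.comp e.injective, ?_, hg⟩
  intro x
  rw [h x]
  constructor
  · rintro ⟨y, rfl⟩
    exact ⟨e.symm y, by simp⟩
  · rintro ⟨y, rfl⟩
    exact ⟨e y, by simp⟩

lemma PSes.congr_right {A B B' : ModuleCat.{u} R} (h : PSes R A B) (e : B ≃ₗ[R] B') :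
    PSes R A B' := by
  obtain ⟨P, f, g, hP, hf, h, hg⟩ := h
  refine ⟨P, f, e.toLinearMap.comp g, hP, hf, ?_, e.surjective.comp hg⟩
  intro x
  rw [← h x]
  simp

/-- A finitely generated submodule of a projective module is controlled by a finite free one. -/
lemma exists_factor {A E : Type u} [AddCommGroup A] [Module R A] [AddCommGroup E] [Module R E]
    [Module.Finite R A] [Module.Projective R E] (f : A →ₗ[R] E) :
    ∃ (F : ModuleCat.{u} R) (φ : E →ₗ[R] F) (ψ : F →ₗ[R] E), Module.Projective R F ∧
      Module.Finite R F ∧ ∀ a, ψ (φ (f a)) = f a := by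
  classical
  obtain ⟨s, hs⟩ := (Module.projective_def' (R := R) (P := E)).1 inferInstance
  obtain ⟨T, hT⟩ := (Module.Finite.fg_top : (⊤ : Submodule R A).FG)
  let X : Finset E := T.biUnion fun t => (s (f t)).support
  have hX : ∀ a, s (f a) ∈ Finsupp.supported R R (X : Set E) := by
    intro a
    have : (⊤ : Submodule R A) ≤ (Finsupp.supported R R (X : Set E)).comap (s.comp f) := by
      rw [← hT, Submodule.span_le]
      intro t ht
      simp only [Submodule.comap_coe, Set.mem_preimage, SetLike.mem_coe]
      rw [Finsupp.mem_supported]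
      intro x hx
      simp only [X, Finset.coe_biUnion, Set.mem_iUnion]
      exact ⟨t, ht, hx⟩
    exact this (Submodule.mem_top (x := a))
  refine ⟨ModuleCat.of R ({x // x ∈ X} →₀ R),
    (Finsupp.lsubtypeDomain (M := R) (R := R) {x | x ∈ X}).comp s,
    Finsupp.linearCombination R (fun x : {x // x ∈ X} => (x : E)), ?_, ?_, ?_⟩
  · dsimp; infer_instance
  · dsimp; infer_instance
  · intro a
    have h1 : Finsupp.linearCombination R id (s (f a)) = f a := LinearMap.congr_fun hs (f a)
    conv_rhs => rw [← h1]
    have h2 := hX a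
    rw [Finsupp.mem_supported] at h2
    have h3 : Finsupp.linearCombination R id (s (f a)) =
        ∑ x ∈ X, (s (f a)) x • x :=
      Finsupp.sum_of_support_subset _ (by exact_mod_cast h2) _ (by simp)
    rw [h3, Finsupp.linearCombination_apply, Finsupp.sum_fintype _ _ (by simp)]
    exact Finset.sum_coe_sort X (fun x => (s (f a)) x • x)

lemma step {A S T : ModuleCat.{u} R} [Module.Finite R A] (h : PSes R A S)
    (P : ModuleCat.{u} R) [hP : Module.Projective R P] (s : S →ₗ[R] P) (q : P →ₗ[R] T)
    (hs : Function.Injective s) (hsq : Function.Exact s q) (hq : Function.Surjective q)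
    (H : ∀ (Q : ModuleCat.{u} R), Module.Projective R Q → ∀ a : S →ₗ[R] Q,
      ∃ b : P →ₗ[R] Q, b.comp s = a) :
    ∃ C : ModuleCat.{u} R, FSes R A C ∧ Module.Finite R C ∧ PSes R C T := by
  obtain ⟨E, i, p, hE, hi, hip, hp⟩ := h
  obtain ⟨F, φ, ψ, hF, hF', hψ⟩ := exists_factor i
  -- the map `χ`
  obtain ⟨χ, hχ⟩ : ∃ χ : S →ₗ[R] E, ∀ e, χ (p e) = e - ψ (φ e) := by
    have hk : LinearMap.ker p ≤ LinearMap.ker (LinearMap.id - ψ.comp φ) := by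
      intro e he
      obtain ⟨a, rfl⟩ := (hip e).1 he
      simp [hψ]
    refine ⟨((LinearMap.ker p).liftQ _ hk).comp (p.quotKerEquivOfSurjective hp).symm.toLinearMap,
      fun e => ?_⟩
    have : (p.quotKerEquivOfSurjective hp).symm (p e) = (LinearMap.ker p).mkQ e := by
      rw [LinearEquiv.symm_apply_eq]; rfl
    simp [this]
  obtain ⟨χ', hχ'⟩ := H E hE χ
  replace hχ' : ∀ x, χ' (s x) = χ x := fun x => LinearMap.congr_fun hχ' x
  let r : (S × F) →ₗ[R] E := χ.coprod ψ
  let r' : (P × F) →ₗ[R] E := χ'.coprod ψ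
  let j : E →ₗ[R] (P × F) := (s.comp p).prod φ
  have hj : ∀ e, r' (j e) = e := by intro e; simp [r', j, hχ', hχ]
  let C : ModuleCat.{u} R := ModuleCat.of R (LinearMap.ker r)
  let g : F →ₗ[R] LinearMap.ker r := LinearMap.codRestrict _
    ((-(p.comp ψ)).prod (LinearMap.id - φ.comp ψ)) (by
      intro f
      simp [r, hχ])
  have hg : Function.Surjective g := by
    rintro ⟨⟨x, f⟩, hxf⟩
    obtain ⟨e, rfl⟩ := hp x
    have h1 : e - ψ (φ e) + ψ f = 0 := by simpa [r, hχ] using hxf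
    have h2 : ψ (f - φ e) = - e := by
      rw [map_sub, ← add_right_inj e, add_neg_cancel, ← h1]; abel
    refine ⟨f - φ e, Subtype.ext (Prod.ext ?_ ?_)⟩
    · change - p (ψ (f - φ e)) = p e
      rw [h2]; simp
    · change f - φ e - φ (ψ (f - φ e)) = f
      rw [h2]; simp
  refine ⟨C, ⟨F, φ.comp i, g, hF, hF', ?_, ?_, hg⟩, Module.Finite.of_surjective g hg,
    ModuleCat.of R (LinearMap.ker r'),
    LinearMap.codRestrict _ ((s.prodMap LinearMap.id).comp (LinearMap.ker r).subtype) ?_,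
    (q.comp (LinearMap.fst R P F)).comp (LinearMap.ker r').subtype, ?_, ?_, ?_, ?_⟩
  · intro a b hab
    apply hi
    rw [← hψ a, ← hψ b]
    exact congrArg ψ hab
  · intro f
    have e1 : g f = 0 ↔ p (ψ f) = 0 ∧ f = φ (ψ f) := by
      rw [← Subtype.coe_inj, Prod.ext_iff]
      change (- p (ψ f) = 0 ∧ f - φ (ψ f) = 0) ↔ _
      rw [neg_eq_zero, sub_eq_zero]
    rw [e1]
    constructor
    · rintro ⟨h1, h2⟩
      obtain ⟨a, ha⟩ := (hip _).1 h1
      exact ⟨a, by rw [h2, ← ha]; rfl⟩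
    · rintro ⟨a, rfl⟩
      simp only [LinearMap.comp_apply, hψ, and_true]
      exact hip.apply_apply_eq_zero a
  · rintro ⟨⟨x, f⟩, hxf⟩
    have h1 : χ x + ψ f = 0 := by simpa [r] using hxf
    change χ' (s x) + ψ f = 0
    rw [hχ', h1]
  · refine Module.Projective.of_split (LinearMap.ker r').subtype
      (LinearMap.codRestrict _ (LinearMap.id - j.comp r') ?_) ?_
    · intro c
      simp [hj]
    · ext x : 1
      have := x.2
      rw [LinearMap.mem_ker] at this
      apply Subtype.ext
      simp [this]
  · rintro ⟨⟨x, f⟩, hx⟩ ⟨⟨y, f'⟩, hy⟩ hxy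
    have := congrArg Subtype.val hxy
    simp only [LinearMap.codRestrict_apply, LinearMap.comp_apply,
      LinearMap.prodMap_apply, Prod.mk.injEq] at this
    have h1 := hs this.1
    have h2 : f = f' := this.2
    subst h1 h2; rfl
  · rintro ⟨⟨y, f⟩, hy⟩
    change q y = 0 ↔ _
    constructor
    · intro h
      obtain ⟨x, rfl⟩ := (hsq y).1 h
      refine ⟨⟨(x, f), ?_⟩, rfl⟩
      simpa [r, r', hχ'] using hy
    · rintro ⟨⟨⟨x, f'⟩, hx⟩, h⟩
      have := congrArg (fun z => q z.1.1) h
      exact this.symm.trans (hsq.apply_apply_eq_zero x)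
  · intro t
    obtain ⟨y, rfl⟩ := hq t
    refine ⟨⟨(y, 0) - j (r' (y, 0)), by simp [hj]⟩, ?_⟩
    change q (y - s (p (r' (y, 0)))) = q y
    rw [map_sub, hsq.apply_apply_eq_zero, sub_zero]

/-- Splicing short exact sequences. -/
lemma unroll (S : ℤ → ModuleCat.{u} R) (h : ∀ i, FSes R (S (i + 1)) (S i)) :
    ∃ (P : ℤ → ModuleCat.{u} R) (d : ∀ i : ℤ, P (i + 1) →ₗ[R] P i),
      (∀ i, Module.Projective R (P i) ∧ Module.Finite R (P i)) ∧
      (∀ i : ℤ, Function.Exact (d (i + 1)) (d i)) ∧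
      ∀ i, Nonempty (S i ≃ₗ[R] LinearMap.range (d i)) := by
  have h' : ∀ j, ∃ (P : ModuleCat.{u} R) (f : S j →ₗ[R] P),
      (Module.Projective R P ∧ Module.Finite R P) ∧ Function.Injective f ∧
      ∀ k, k + 1 = j → ∃ g : P →ₗ[R] S k, Function.Exact f g ∧ Function.Surjective g := by
    intro j
    obtain ⟨k, rfl⟩ : ∃ k, j = k + 1 := ⟨j - 1, by ring⟩
    obtain ⟨P, f, g, h1, h2, h3, h4, h5⟩ := h k
    refine ⟨P, f, ⟨h1, h2⟩, h3, fun l hl => ?_⟩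
    obtain rfl : l = k := by omega
    exact ⟨g, h4, h5⟩
  choose P f hP hf hg using h'
  choose g hfg hgs using fun k => hg (k + 1) k rfl
  refine ⟨P, fun i => (f i).comp (g i), hP, fun i => ?_, fun i => ?_⟩
  · intro x
    simp only [LinearMap.comp_apply, map_eq_zero_iff _ (hf i)]
    rw [hfg i x]
    constructor
    · rintro ⟨y, rfl⟩
      obtain ⟨z, rfl⟩ := hgs _ y
      exact ⟨z, rfl⟩
    · rintro ⟨z, rfl⟩
      exact ⟨_, rfl⟩
  · have : LinearMap.range ((f i).comp (g i)) = LinearMap.range (f i) :=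
      LinearMap.range_comp_of_range_eq_top _ (LinearMap.range_eq_top.2 (hgs i))
    rw [this]
    exact ⟨LinearEquiv.ofInjective (f i) (hf i)⟩

end

end NSGAux

namespace NSGAux

section
variable {R : Type u} [Ring R] {P : ℤ → ModuleCat.{u} R} {d : ∀ i : ℤ, P (i + 1) →ₗ[R] P i}

/-- The syzygies of a complex. -/
noncomputable abbrev syz (d : ∀ i : ℤ, P (i + 1) →ₗ[R] P i) (i : ℤ) : ModuleCat.{u} R :=
  ModuleCat.of R (LinearMap.range (d i))

lemma syz_exact (hd : ∀ i : ℤ, Function.Exact (d (i + 1)) (d i)) (i : ℤ) :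
    Function.Exact (LinearMap.range (d (i + 1))).subtype (d i).rangeRestrict := by
  intro x
  rw [← Subtype.coe_inj]
  change d i x = 0 ↔ _
  rw [hd i x]
  constructor
  · rintro ⟨y, rfl⟩
    exact ⟨⟨_, y, rfl⟩, rfl⟩
  · rintro ⟨⟨_, y, rfl⟩, rfl⟩
    exact ⟨y, rfl⟩

lemma extend_of_homExact (hd : ∀ i : ℤ, Function.Exact (d (i + 1)) (d i))
    (hH : IsHomExact R P d) (Q : ModuleCat.{u} R) (hQ : Module.Projective R Q) (i : ℤ)
    (a : LinearMap.range (d i) →ₗ[R] Q) :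
    ∃ b : P i →ₗ[R] Q, b.comp (LinearMap.range (d i)).subtype = a := by
  obtain ⟨b, hb⟩ := (hH Q hQ i (a.comp (d i).rangeRestrict)).1 (by
    ext x
    have : (d i).rangeRestrict (d (i + 1) x) = 0 :=
      Subtype.ext ((hd i).apply_apply_eq_zero x)
    simp [this])
  refine ⟨b, ?_⟩
  ext ⟨_, y, rfl⟩
  exact LinearMap.congr_fun hb y

lemma V_shift_syz (hd : ∀ i : ℤ, Function.Exact (d (i + 1)) (d i))
    (hP : ∀ i, Module.Projective R (P i)) (Y : Type u) [AddCommGroup Y] [Module R Y]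
    (i : ℤ) (m : ℕ) : V R (syz d (i + 1)) Y (m + 1) ↔ V R (syz d i) Y (m + 2) :=
  haveI := hP (i + 1)
  V_shift (Submodule.injective_subtype _) (syz_exact hd i) (d i).surjective_rangeRestrict m

lemma V_of_homExact (hd : ∀ i : ℤ, Function.Exact (d (i + 1)) (d i))
    (hP : ∀ i, Module.Projective R (P i)) (hH : IsHomExact R P d) (m : ℕ) (i : ℤ) :
    V R (syz d i) R (m + 1) := by
  induction m generalizing i with
  | zero =>
    haveI := hP (i + 1)
    exact V_of_extend (Submodule.injective_subtype _) (syz_exact hd i)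
      (d i).surjective_rangeRestrict
      (fun a => extend_of_homExact hd hH (ModuleCat.of R R) inferInstance (i + 1) a)
  | succ m ih => exact (V_shift_syz hd hP R i m).1 (ih (i + 1))

lemma V_syz_add (hd : ∀ i : ℤ, Function.Exact (d (i + 1)) (d i))
    (hP : ∀ i, Module.Projective R (P i)) (i : ℤ)
    (h : ∀ m : ℕ, V R (syz d i) R (m + 1)) (j : ℕ) :
    ∀ m : ℕ, V R (syz d (i + j)) R (m + 1) := by
  induction j with
  | zero =>
    have : i + ((0 : ℕ) : ℤ) = i := by simp
    rw [this]
    exact h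
  | succ j ih =>
    intro m
    have : i + ((j + 1 : ℕ) : ℤ) = (i + j) + 1 := by push_cast; ring
    rw [this]
    exact (V_shift_syz hd hP R _ m).2 (ih (m + 1))

/-- Lifting property for maps to `Y`. -/
def Lifts (d : ∀ i : ℤ, P (i + 1) →ₗ[R] P i) (Y : Type u) [AddCommGroup Y] [Module R Y] : Prop :=
  ∀ (i : ℤ) (g : P (i + 1) →ₗ[R] Y), g.comp (d (i + 1)) = 0 →
    ∃ h : P i →ₗ[R] Y, h.comp (d i) = g

lemma lifts_of_V (hd : ∀ i : ℤ, Function.Exact (d (i + 1)) (d i))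
    (h : ∀ i, V R (syz d i) R 1) : Lifts d R := by
  intro i g hg
  obtain ⟨j, rfl⟩ : ∃ j, i = j + 1 := ⟨i - 1, by ring⟩
  have hk : LinearMap.ker (d (j + 1)) ≤ LinearMap.ker g := by
    intro x hx
    obtain ⟨y, rfl⟩ := (hd (j + 1) x).1 hx
    exact LinearMap.congr_fun hg y
  obtain ⟨b, hb⟩ := extend_of_V (Submodule.injective_subtype _) (syz_exact hd j)
    (d j).surjective_rangeRestrict (h j)
    (((LinearMap.ker (d (j + 1))).liftQ g hk).comp (d (j + 1)).quotKerEquivRange.symm.toLinearMap)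
  refine ⟨b, ?_⟩
  ext x
  have h1 := LinearMap.congr_fun hb ⟨d (j + 1) x, x, rfl⟩
  have h2 : (d (j + 1)).quotKerEquivRange.symm ⟨d (j + 1) x, x, rfl⟩ =
      (LinearMap.ker (d (j + 1))).mkQ x := by
    rw [LinearEquiv.symm_apply_eq]; rfl
  simpa [h2] using h1

lemma lifts_free (hF : ∀ i, Module.Finite R (P i)) (h : Lifts d R) (X : Type u) :
    Lifts d (X →₀ R) := by
  classical
  intro i g hg
  have h1 : ∀ x, ∃ b : P i →ₗ[R] R, b.comp (d i) = (Finsupp.lapply x).comp g := by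
    intro x
    apply h
    rw [LinearMap.comp_assoc, hg, LinearMap.comp_zero]
  choose b hb using h1
  obtain ⟨T, hT⟩ := ((hF (i + 1)).1 : (⊤ : Submodule R (P (i + 1))).FG)
  let X' : Finset X := T.biUnion fun t => (g t).support
  have hX : ∀ a, (g a).support ⊆ X' := by
    intro a
    have : (⊤ : Submodule R (P (i + 1))) ≤ (Finsupp.supported R R (X' : Set X)).comap g := by
      rw [← hT, Submodule.span_le]
      intro t ht
      simp only [Submodule.comap_coe, Set.mem_preimage, SetLike.mem_coe]
      rw [Finsupp.mem_supported]
      intro x hx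
      simp only [X', Finset.coe_biUnion, Set.mem_iUnion]
      exact ⟨t, ht, hx⟩
    have h2 := this (Submodule.mem_top (x := a))
    rw [Submodule.mem_comap, Finsupp.mem_supported] at h2
    exact_mod_cast h2
  refine ⟨∑ x ∈ X', (Finsupp.lsingle x).comp (b x), ?_⟩
  refine LinearMap.ext fun a => ?_
  have h3 : ∀ x, b x (d i a) = g a x := fun x => LinearMap.congr_fun (hb x) a
  have h4 : (g a).sum Finsupp.single = ∑ x ∈ X', Finsupp.single x (g a x) :=
    Finsupp.sum_of_support_subset _ (hX a) _ (by simp)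
  rw [Finsupp.sum_single] at h4
  rw [h4]
  simp [h3]

lemma homExact_of_lifts (hd : ∀ i : ℤ, Function.Exact (d (i + 1)) (d i))
    (hF : ∀ i, Module.Finite R (P i)) (h : Lifts d R) : IsHomExact R P d := by
  intro Q hQ i g
  constructor
  · intro hg
    obtain ⟨s, hs⟩ := (Module.projective_def' (R := R) (P := Q)).1 hQ
    obtain ⟨b, hb⟩ := lifts_free hF h Q i (s.comp g) (by
      change g.comp (d (i + 1)) = 0 at hg
      rw [LinearMap.comp_assoc, hg, LinearMap.comp_zero])
    refine ⟨(Finsupp.linearCombination R id).comp b, ?_⟩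
    change ((Finsupp.linearCombination R id).comp b).comp (d i) = g
    rw [LinearMap.comp_assoc, hb, ← LinearMap.comp_assoc, hs, LinearMap.id_comp]
  · rintro ⟨b, rfl⟩
    ext x
    simp [(hd i).apply_apply_eq_zero x]

/-- The sequence of finitely generated cosyzygies. -/
lemma exists_seq (hd : ∀ i : ℤ, Function.Exact (d (i + 1)) (d i))
    (hP : ∀ i, Module.Projective R (P i)) (hH : IsHomExact R P d) (N : ℤ)
    (M : ModuleCat.{u} R) (hM : Module.Finite R M) (e : PSes R M (syz d N)) :
    ∃ C : ℕ → ModuleCat.{u} R, C 0 = M ∧ (∀ m, FSes R (C m) (C (m + 1))) ∧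
      ∀ m : ℕ, Module.Finite R (C m) ∧ PSes R (C m) (syz d (N - m)) := by
  have key : ∀ (m : ℕ) (X : {X : ModuleCat.{u} R // Module.Finite R X ∧ PSes R X (syz d (N - m))}),
      ∃ X' : {X : ModuleCat.{u} R // Module.Finite R X ∧ PSes R X (syz d (N - (m + 1 : ℕ)))},
        FSes R X.1 X'.1 := by
    rintro m ⟨X, hX, hX'⟩
    have hi : N - (m : ℤ) = (N - (m + 1 : ℕ)) + 1 := by push_cast; ring
    rw [hi] at hX'
    generalize N - ((m + 1 : ℕ) : ℤ) = i at *
    haveI := hP (i + 1)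
    obtain ⟨C, h1, h2, h3⟩ := step (T := syz d i) hX' (P (i + 1))
      (LinearMap.range (d (i + 1))).subtype (d i).rangeRestrict
      (Submodule.injective_subtype _) (syz_exact hd i) (d i).surjective_rangeRestrict
      (fun Q hQ a => extend_of_homExact hd hH Q hQ (i + 1) a)
    exact ⟨⟨C, h2, h3⟩, h1⟩
  choose F hF using key
  let C : ∀ m : ℕ, {X : ModuleCat.{u} R // Module.Finite R X ∧ PSes R X (syz d (N - m))} :=
    fun m => Nat.rec ⟨M, hM, by simpa using e⟩ (fun m X => F m X) m
  exact ⟨fun m => (C m).1, rfl, fun m => hF m (C m), fun m => (C m).2⟩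

end

end NSGAux

/-- A finitely generated module `M` is `n`-strongly Gorenstein projective iff there is
an exact sequence `0 → M → P_{n-1} → ⋯ → P_0 → M → 0` of finitely generated modules
with each `P i` projective, and `Ext^i(M, R) = 0` for all `i ≥ 1`. -/
theorem nSGProjective_iff_fg_seq_ext_vanishes (R : Type u) [Ring R] (n : ℕ) (hn : 0 < n)
    (M : Type u) [AddCommGroup M] [Module R M] [Module.Finite R M] :
    IsNSGProjective R n M ↔
      ∃ (P : ℤ → ModuleCat.{u} R) (d : ∀ i : ℤ, P (i + 1) →ₗ[R] P i),
        (∀ i, Module.Projective R (P i) ∧ Module.Finite R (P i)) ∧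
        IsPeriodicExact R n M P d ∧
        ∀ i : ℕ, 1 ≤ i →
          Subsingleton (((Ext ℤ (ModuleCat.{u} R) i).obj
            (Opposite.op (ModuleCat.of R M))).obj (ModuleCat.of R R)) := by
  open NSGAux in
  constructor
  · rintro ⟨P, d, hP, ⟨hd, hM⟩, hH⟩
    have hV : ∀ i : ℕ, 1 ≤ i →
          Subsingleton (((Ext ℤ (ModuleCat.{u} R) i).obj
            (Opposite.op (ModuleCat.of R M))).obj (ModuleCat.of R R)) := by
      intro i hi
      obtain ⟨m, rfl⟩ : ∃ m, i = m + 1 := ⟨i - 1, by omega⟩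
      rw [old_iff_new]
      obtain ⟨e⟩ := hM 0
      exact V_iso e.symm (m + 1) (V_of_homExact hd hP hH m _)
    have e0 : PSes R (ModuleCat.of R M) (syz d ((n : ℤ) - 1)) := by
      obtain ⟨e⟩ := hM 1
      have hi : (n : ℤ) * 1 = ((n : ℤ) - 1) + 1 := by ring
      rw [hi] at e
      refine PSes.congr_left (A := syz d (((n : ℤ) - 1) + 1)) ⟨P (((n : ℤ) - 1) + 1), _, _, hP _,
        Submodule.injective_subtype _, syz_exact hd _, (d _).surjective_rangeRestrict⟩ e
    obtain ⟨C, hC0, hC, hC'⟩ := exists_seq hd hP hH _ _ ‹_› e0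
    have hlast : FSes R (C (n - 1)) (C 0) := by
      obtain ⟨h1, h2⟩ := hC' (n - 1)
      obtain ⟨e⟩ := hM 0
      have hi : (n : ℤ) - 1 - ((n - 1 : ℕ) : ℤ) = (n : ℤ) * 0 := by
        rw [Nat.cast_sub (by omega)]; push_cast; ring
      rw [hi] at h2
      rw [hC0]
      exact (h2.congr_right (B' := ModuleCat.of R M) e.symm).toFSes h1 ‹_›
    have hn' : (0 : ℤ) < n := by exact_mod_cast hn
    obtain ⟨P', d', h1, h2, h3⟩ := unroll (fun i : ℤ => C ((-i) % (n : ℤ)).toNat) (by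
      intro i
      have a1 := Int.emod_nonneg (-(i + 1)) hn'.ne'
      have a2 := Int.emod_lt_of_pos (-(i + 1)) hn'
      have a3 : (-i) % (n : ℤ) = ((-(i + 1)) % (n : ℤ) + 1) % n := by
        rw [Int.emod_add_emod]; congr 1; ring
      rw [a3]
      generalize (-(i + 1)) % (n : ℤ) = r at *
      by_cases hr : r + 1 < n
      · rw [Int.emod_eq_of_lt (by omega) hr, Int.toNat_add a1 (by omega)]
        exact hC _
      · obtain rfl : r = n - 1 := by omega
        have b1 : ((n : ℤ) - 1).toNat = n - 1 := by omega
        rw [sub_add_cancel, Int.emod_self, b1]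
        exact hlast)
    refine ⟨P', d', h1, ⟨h2, fun k => ?_⟩, hV⟩
    have h4 := h3 ((n : ℤ) * k)
    have : (-((n : ℤ) * k)) % (n : ℤ) = 0 := by simp
    rw [this, Int.toNat_zero, hC0] at h4
    exact h4
  · rintro ⟨P, d, hP, ⟨hd, hM⟩, hV⟩
    refine ⟨P, d, fun i => (hP i).1, ⟨hd, hM⟩,
      homExact_of_lifts hd (fun i => (hP i).2) (lifts_of_V hd fun i => ?_)⟩
    have hn' : (0 : ℤ) < n := by exact_mod_cast hn
    have h0 : ∀ m : ℕ, V R (syz d ((n : ℤ) * (i / n))) R (m + 1) := by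
      intro m
      obtain ⟨e⟩ := hM (i / n)
      exact V_iso e (m + 1) ((old_iff_new R _ _ m).1 (hV (m + 1) (by omega)))
    have := V_syz_add hd (fun i => (hP i).1) _ h0 (i % n).toNat 0
    have hi : (n : ℤ) * (i / n) + ((i % n).toNat : ℤ) = i := by
      rw [Int.toNat_of_nonneg (Int.emod_nonneg _ hn'.ne')]
      exact Int.mul_ediv_add_emod i n
    rw [hi] at this
    exact this
end

section
/- A finitely generated module M is n-strongly Gorenstein projective if and only if there is an exact sequence 0 → M → P_{n−1} → ⋯ → P₀ → M → 0 of finitely generated projectives and Ext^i_R(M, F) = 0 for every module F of finite flat dimension and all i ≥ 1. -/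
open CategoryTheory DirectSum

universe u

section FlatDefs

variable (R : Type u) [CommRing R]

/-- The complex stays exact after applying `I ⊗_R -` for every injective module `I`. -/
def IsTensorExact (P : ℤ → ModuleCat.{u} R) (d : ∀ i : ℤ, P (i + 1) →ₗ[R] P i) : Prop :=
  ∀ (I : ModuleCat.{u} R), Module.Injective R I →
    ∀ i : ℤ, Function.Exact (LinearMap.lTensor I (d (i + 1))) (LinearMap.lTensor I (d i))

/-- `M` is `n`-strongly Gorenstein flat: there is an exact sequence
`0 → M → F_{n-1} → ⋯ → F_0 → M → 0` with all `F i` flat which stays exact under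
`I ⊗_R -` for every injective `I` (encoded via its periodic unrolling). -/
def IsNSGFlat (n : ℕ) (M : Type u) [AddCommGroup M] [Module R M] : Prop :=
  ∃ (P : ℤ → ModuleCat.{u} R) (d : ∀ i : ℤ, P (i + 1) →ₗ[R] P i),
    (∀ i, Module.Flat R (P i)) ∧ IsPeriodicExact R n M P d ∧ IsTensorExact R P d

/-- `M` is Gorenstein flat: it is a syzygy of an exact complex of flat modules which
stays exact under `I ⊗_R -` for every injective `I`. -/
def IsGFlat (M : Type u) [AddCommGroup M] [Module R M] : Prop :=
  ∃ (P : ℤ → ModuleCat.{u} R) (d : ∀ i : ℤ, P (i + 1) →ₗ[R] P i),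
    (∀ i, Module.Flat R (P i)) ∧ (∀ i : ℤ, Function.Exact (d (i + 1)) (d i)) ∧
    IsTensorExact R P d ∧ Nonempty (M ≃ₗ[R] LinearMap.range (d 0))

/-- The flat dimension of `M` is at most `m`. -/
def flatDimLE : ℕ → ModuleCat.{u} R → Prop
  | 0, M => Module.Flat R M
  | m + 1, M => ∃ (F : ModuleCat.{u} R) (f : F →ₗ[R] M), Module.Flat R F ∧
      Function.Surjective f ∧ flatDimLE m (ModuleCat.of R (LinearMap.ker f))

/-- The complex stays exact after applying `Hom_R(X, -)` for every injective `X`. -/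
def IsCohomExact (E : ℤ → ModuleCat.{u} R) (d : ∀ i : ℤ, E (i + 1) →ₗ[R] E i) : Prop :=
  ∀ (X : ModuleCat.{u} R), Module.Injective R X →
    ∀ i : ℤ, Function.Exact (fun g : X →ₗ[R] E (i + 1 + 1) => (d (i + 1)).comp g)
      (fun g : X →ₗ[R] E (i + 1) => (d i).comp g)

/-- `M` is `n`-strongly Gorenstein injective: there is an exact sequence
`0 → M → E^{n-1} → ⋯ → E^0 → M → 0` with all `E i` injective which stays exact under
`Hom_R(X, -)` for every injective `X` (encoded via its periodic unrolling). -/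
def IsNSGInjective (n : ℕ) (M : Type u) [AddCommGroup M] [Module R M] : Prop :=
  ∃ (E : ℤ → ModuleCat.{u} R) (d : ∀ i : ℤ, E (i + 1) →ₗ[R] E i),
    (∀ i, Module.Injective R (E i)) ∧ IsPeriodicExact R n M E d ∧ IsCohomExact R E d

end FlatDefs

section ExtAux

/-- The projective resolution built from an explicit exact sequence of modules. -/
noncomputable def auxRes {R : Type u} [CommRing R] {M : ModuleCat.{u} R}
    (Q : ℕ → ModuleCat.{u} R) (δ : ∀ m : ℕ, Q (m + 1) →ₗ[R] Q m) (ε : Q 0 →ₗ[R] M)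
    (hQ : ∀ m, Module.Projective R (Q m))
    (hδ : ∀ m, Function.Exact (δ (m + 1)) (δ m))
    (hε : Function.Surjective ε) (hδε : Function.Exact (δ 0) ε) :
    ProjectiveResolution M where
  complex := ChainComplex.of Q (fun m => ModuleCat.ofHom (δ m)) (fun m => by
    ext x
    exact (hδ m).apply_apply_eq_zero x)
  projective := fun m => (IsProjective.iff_projective (R := R) (Q m)).1 (hQ m)
  π := (ChainComplex.toSingle₀Equiv _ _).symm ⟨ModuleCat.ofHom ε, by
    rw [show (ChainComplex.of Q (fun m => ModuleCat.ofHom (δ m)) _).d 1 0 = ModuleCat.ofHom (δ 0)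
      from ChainComplex.of_d Q (fun m => ModuleCat.ofHom (δ m)) 0]
    ext x
    exact hδε.apply_apply_eq_zero x⟩
  quasiIso := ⟨fun n => by
    cases n
    · rw [ChainComplex.quasiIsoAt₀_iff, ShortComplex.quasiIso_iff_of_zeros']
      · refine (ShortComplex.exact_and_epi_g_iff_of_iso
          (S₂ := ShortComplex.mk (ModuleCat.ofHom (δ 0)) (ModuleCat.ofHom ε) ?_) ?_).2 ⟨?_, ?_⟩
        · ext x
          exact hδε.apply_apply_eq_zero x
        · refine ShortComplex.isoMk (Iso.refl _) (Iso.refl _) (Iso.refl _) ?_ ?_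
          · have := ChainComplex.of_d Q (fun m => ModuleCat.ofHom (δ m)) 0
            exact (Category.id_comp (ModuleCat.ofHom (δ 0))).trans
              (this.symm.trans (Category.comp_id _).symm)
          · refine (Category.id_comp (ModuleCat.ofHom ε)).trans ?_
            refine Eq.trans ?_ (Category.comp_id _).symm
            symm
            apply ChainComplex.toSingle₀Equiv_symm_apply_f_zero
        · rw [ShortComplex.ShortExact.moduleCat_exact_iff_function_exact]
          exact hδε
        · exact (ModuleCat.epi_iff_surjective _).2 hε
      all_goals rfl
    · rename_i n
      rw [quasiIsoAt_iff_exactAt']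
      · rw [HomologicalComplex.exactAt_iff' _ (n + 1 + 1) (n + 1) n (by simp) (by simp),
          ShortComplex.ShortExact.moduleCat_exact_iff_function_exact]
        have h1 := ChainComplex.of_d Q (fun m => ModuleCat.ofHom (δ m)) (n + 1)
        have h2 := ChainComplex.of_d Q (fun m => ModuleCat.ofHom (δ m)) n
        simp only [HomologicalComplex.sc', HomologicalComplex.shortComplexFunctor'_obj_f, HomologicalComplex.shortComplexFunctor'_obj_g]
        rw [h1, h2]
        exact hδ n
      · apply ChainComplex.exactAt_succ_single_obj⟩

theorem auxExt {R : Type u} [CommRing R] {M : ModuleCat.{u} R}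
    (Q : ℕ → ModuleCat.{u} R) (δ : ∀ m : ℕ, Q (m + 1) →ₗ[R] Q m) (ε : Q 0 →ₗ[R] M)
    (hQ : ∀ m, Module.Projective R (Q m))
    (hδ : ∀ m, Function.Exact (δ (m + 1)) (δ m))
    (hε : Function.Surjective ε) (hδε : Function.Exact (δ 0) ε) (F : ModuleCat.{u} R) (m : ℕ) :
    Subsingleton (((Ext ℤ (ModuleCat.{u} R) (m + 1)).obj (Opposite.op M)).obj F) ↔
    Function.Exact (fun g : Q m →ₗ[R] F => g.comp (δ m))
      (fun g : Q (m + 1) →ₗ[R] F => g.comp (δ (m + 1))) := by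
  rw [← ModuleCat.isZero_iff_subsingleton]
  let P := auxRes Q δ ε hQ hδ hε hδε
  rw [(P.isoExt (R := ℤ) (m + 1) F).isZero_iff, ← HomologicalComplex.exactAt_iff_isZero_homology,
    HomologicalComplex.exactAt_iff' _ m (m + 1) (m + 1 + 1) (by simp) (by simp),
    ShortComplex.ShortExact.moduleCat_exact_iff_function_exact]
  have h1 : P.complex.d (m + 1) m = ModuleCat.ofHom (δ m) :=
    ChainComplex.of_d Q (fun m => ModuleCat.ofHom (δ m)) m
  have h2 : P.complex.d (m + 1 + 1) (m + 1) = ModuleCat.ofHom (δ (m + 1)) :=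
    ChainComplex.of_d Q (fun m => ModuleCat.ofHom (δ m)) (m + 1)
  have key : ∀ (x : Q m ⟶ F), ((P.complex.linearYonedaObj ℤ F).sc' m (m+1) (m+1+1)).f x = 
     (ModuleCat.ofHom (δ m) ≫ x : Q (m + 1) ⟶ F) := by
    intro x
    rw [← h1]; rfl
  have key2 : ∀ (x : Q (m + 1) ⟶ F), ((P.complex.linearYonedaObj ℤ F).sc' m (m+1) (m+1+1)).g x = 
     (ModuleCat.ofHom (δ (m + 1)) ≫ x : Q (m + 1 + 1) ⟶ F) := by
    intro x
    rw [← h2]; rfl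
  constructor
  · intro H y
    refine Iff.trans ?_ ((H (ModuleCat.ofHom y : Q (m + 1) ⟶ F)).trans ?_)
    · rw [key2]
      constructor
      · intro h
        have h' : y.comp (δ (m + 1)) = 0 := h
        have : (ModuleCat.ofHom (δ (m + 1)) ≫ ModuleCat.ofHom y : Q (m + 1 + 1) ⟶ F) = 0 := by
          rw [← ModuleCat.ofHom_comp, h']; rfl
        exact this
      · intro h
        exact congrArg (fun z : Q (m + 1 + 1) ⟶ F => z.hom) h
    · constructor
      · rintro ⟨x, hx⟩
        have hx' := (key x).symm.trans hx
        exact ⟨ModuleCat.Hom.hom (x : Q m ⟶ F),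
          congrArg (fun z : Q (m + 1) ⟶ F => z.hom) hx'⟩
      · rintro ⟨x, hx⟩
        refine ⟨(ModuleCat.ofHom x : Q m ⟶ F), (key _).trans ?_⟩
        rw [← ModuleCat.ofHom_comp]
        exact congrArg (fun z : Q (m + 1) →ₗ[R] F => ModuleCat.ofHom z) hx
  · intro H y
    refine Iff.trans ?_ ((H (ModuleCat.Hom.hom (y : Q (m + 1) ⟶ F))).trans ?_)
    · constructor
      · intro h
        exact congrArg (fun z : Q (m + 1 + 1) ⟶ F => z.hom) ((key2 y).symm.trans h)
      · intro h
        exact (key2 y).trans (congrArg (fun z : Q (m + 1 + 1) →ₗ[R] F => ModuleCat.ofHom z) h)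
    · constructor
      · rintro ⟨x, hx⟩
        refine ⟨(ModuleCat.ofHom x : Q m ⟶ F), (key _).trans ?_⟩
        rw [← ModuleCat.ofHom_comp]
        exact congrArg (fun z : Q (m + 1) →ₗ[R] F => ModuleCat.ofHom z) hx
      · rintro ⟨x, hx⟩
        have hx' := (key x).symm.trans hx
        exact ⟨ModuleCat.Hom.hom (x : Q m ⟶ F),
          congrArg (fun z : Q (m + 1) ⟶ F => z.hom) hx'⟩

end ExtAux
section ModAux

variable {R : Type u} [CommRing R]

/-- Maps to projectives extend along `j`. -/
def AuxExtends {X P : Type u} [AddCommGroup X] [Module R X] [AddCommGroup P] [Module R P]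
    (j : X →ₗ[R] P) : Prop :=
  ∀ (Q : ModuleCat.{u} R), Module.Projective R Q → ∀ f : X →ₗ[R] Q, ∃ g : P →ₗ[R] Q,
    g.comp j = f

theorem aux_strip {N A T N' A' : Type u} [AddCommGroup N] [Module R N] [AddCommGroup A] [Module R A]
    [AddCommGroup T] [Module R T] [AddCommGroup N'] [Module R N'] [AddCommGroup A'] [Module R A']
    [Module.Projective R A] [Module.Projective R T] [Module.Projective R A']
    (j : N × A →ₗ[R] T) (p : T →ₗ[R] N' × A') (hj : Function.Injective j)
    (hp : Function.Surjective p) (hjp : Function.Exact j p) (hext : AuxExtends j) :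
    ∃ (G : ModuleCat.{u} R) (ι : N →ₗ[R] G) (π : G →ₗ[R] N'), Module.Projective R G ∧
      Function.Injective ι ∧ Function.Surjective π ∧ Function.Exact ι π ∧ AuxExtends ι := by
  obtain ⟨r, hr⟩ := hext (ModuleCat.of R A) ‹_› (LinearMap.snd R N A)
  change T →ₗ[R] A at r
  have hr' : ∀ x, r (j x) = x.2 := fun x => LinearMap.congr_fun hr x
  have hpj : ∀ x, p (j x) = 0 := fun x => hjp.apply_apply_eq_zero x
  let φ : T →ₗ[R] A × A' := r.prod ((LinearMap.snd R N' A').comp p)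
  have hφ : Function.Surjective φ := by
    rintro ⟨a, a'⟩
    obtain ⟨t, ht⟩ := hp (0, a')
    refine ⟨t + j (0, a - r t), ?_⟩
    simp [φ, hr', hpj, ht]
  have hker : ∀ t, t ∈ LinearMap.ker φ ↔ r t = 0 ∧ (p t).2 = 0 := by
    intro t; simp [φ]
  obtain ⟨s, hs⟩ := Module.projective_lifting_property φ LinearMap.id hφ
  have hs' : ∀ x, φ (s x) = x := fun x => LinearMap.congr_fun hs x
  have hproj : Module.Projective R (LinearMap.ker φ) := by
    refine Module.Projective.of_split (LinearMap.ker φ).subtype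
      (LinearMap.codRestrict (LinearMap.ker φ) (LinearMap.id - s.comp φ) ?_) ?_
    · intro t
      simp [hs']
    · ext ⟨t, ht⟩
      have : φ t = 0 := ht
      simp [this]
  refine ⟨ModuleCat.of R (LinearMap.ker φ),
    LinearMap.codRestrict (LinearMap.ker φ) (j.comp (LinearMap.inl R N A)) ?_,
    (LinearMap.fst R N' A').comp (p.comp (LinearMap.ker φ).subtype), hproj, ?_, ?_, ?_, ?_⟩
  · intro n
    rw [hker]
    simp [hr', hpj]
  · intro a b hab
    have h1 : j (a, 0) = j (b, 0) := congrArg Subtype.val hab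
    exact (Prod.ext_iff.1 (hj h1)).1
  · intro n'
    obtain ⟨t, ht⟩ := hp (n', 0)
    refine ⟨⟨t - j (0, r t), ?_⟩, ?_⟩
    · rw [hker]
      simp [hr', hpj, ht]
    · change (p (t - j (0, r t))).1 = n'
      simp [hpj, ht]
  · rintro ⟨t, ht⟩
    have ht' := (hker t).1 ht
    constructor
    · intro h
      have h1 : (p t).1 = 0 := h
      obtain ⟨⟨n, a⟩, hna⟩ := (hjp t).1 (Prod.ext h1 ht'.2)
      have ha : a = 0 := by
        have := hr' (n, a)
        rw [hna, ht'.1] at this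
        exact this.symm
      subst ha
      exact ⟨n, Subtype.ext hna⟩
    · rintro ⟨n, hn⟩
      have h1 : j (n, 0) = t := congrArg Subtype.val hn
      change (p t).1 = 0
      rw [← h1, hpj]; rfl
  · intro Q hQ f
    obtain ⟨g, hg⟩ := hext Q hQ (f.comp (LinearMap.fst R N A))
    refine ⟨g.comp (LinearMap.ker φ).subtype, ?_⟩
    ext n
    exact LinearMap.congr_fun hg (n, 0)

/-- stable equivalence -/
def AuxStable (N X : Type u) [AddCommGroup N] [Module R N] [AddCommGroup X] [Module R X] : Prop :=
  ∃ A B : ModuleCat.{u} R, Module.Projective R A ∧ Module.Projective R B ∧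
    Nonempty ((N × A) ≃ₗ[R] (X × B))

theorem AuxStable.of_equiv {N X : Type u} [AddCommGroup N] [Module R N] [AddCommGroup X]
    [Module R X] (e : N ≃ₗ[R] X) : AuxStable (R := R) N X :=
  ⟨ModuleCat.of R PUnit.{u + 1}, ModuleCat.of R PUnit.{u + 1},
    inferInstanceAs (Module.Projective R PUnit.{u + 1}),
    inferInstanceAs (Module.Projective R PUnit.{u + 1}),
    ⟨LinearEquiv.prodCongr e (LinearEquiv.refl R _)⟩⟩

theorem aux_replace {N N' X P Y : Type u} [AddCommGroup N] [Module R N]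
    [AddCommGroup N'] [Module R N'] [AddCommGroup X] [Module R X]
    [AddCommGroup P] [Module R P] [AddCommGroup Y] [Module R Y] [Module.Projective R P]
    (j : X →ₗ[R] P) (p : P →ₗ[R] Y) (hj : Function.Injective j)
    (hp : Function.Surjective p) (hjp : Function.Exact j p) (hext : AuxExtends j)
    (h : AuxStable (R := R) N X) (h' : AuxStable (R := R) N' Y) :
    ∃ (G : ModuleCat.{u} R) (ι : N →ₗ[R] G) (π : G →ₗ[R] N'), Module.Projective R G ∧
      Function.Injective ι ∧ Function.Surjective π ∧ Function.Exact ι π ∧ AuxExtends ι := by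
  obtain ⟨A, B, hA, hB, ⟨e⟩⟩ := h
  obtain ⟨A', B', hA', hB', ⟨e'⟩⟩ := h'
  let J0 : X × B →ₗ[R] (P × B) × B' :=
    (LinearMap.inl R (P × B) B').comp (LinearMap.prodMap j LinearMap.id)
  let p0 : (P × B) × B' →ₗ[R] Y × B' :=
    LinearMap.prodMap (p.comp (LinearMap.fst R P B)) LinearMap.id
  refine aux_strip (A := A) (A' := A') (T := (P × B) × B')
    (J0.comp e.toLinearMap) (e'.symm.toLinearMap.comp p0) ?_ ?_ ?_ ?_
  · have : Function.Injective J0 := by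
      rintro ⟨x, b⟩ ⟨x', b'⟩ h
      simp only [J0, LinearMap.comp_apply, LinearMap.prodMap_apply, LinearMap.inl_apply,
        Prod.mk.injEq, LinearMap.id_apply] at h
      exact Prod.ext (hj h.1.1) h.1.2
    exact this.comp e.injective
  · have : Function.Surjective p0 := by
      rintro ⟨y, b'⟩
      obtain ⟨x, rfl⟩ := hp y
      exact ⟨((x, 0), b'), rfl⟩
    exact e'.symm.surjective.comp this
  · rintro ⟨⟨x, b⟩, b'⟩
    constructor
    · intro h
      have h1 : p0 ((x, b), b') = 0 := e'.symm.injective (h.trans (map_zero _).symm)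
      have hx : p x = 0 := congrArg Prod.fst h1
      have hb : b' = 0 := congrArg Prod.snd h1
      obtain ⟨z, rfl⟩ := (hjp x).1 hx
      subst hb
      refine ⟨e.symm (z, b), ?_⟩
      simp [J0]
    · rintro ⟨z, hz⟩
      have h1 : p0 (J0 (e z)) = 0 := Prod.ext (hjp.apply_apply_eq_zero _) rfl
      rw [← hz]
      change e'.symm (p0 (J0 (e z))) = 0
      rw [h1, map_zero]
  · intro Q hQ f
    obtain ⟨g, hg⟩ := hext Q hQ ((f.comp e.symm.toLinearMap).comp (LinearMap.inl R X B))
    refine ⟨(LinearMap.coprod g ((f.comp e.symm.toLinearMap).comp (LinearMap.inr R X B))).comp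
      (LinearMap.fst R (P × B) B'), ?_⟩
    refine LinearMap.ext fun z => ?_
    obtain ⟨⟨x, b⟩, rfl⟩ := e.symm.surjective z
    have h1 : g (j x) = f (e.symm (x, 0)) := LinearMap.congr_fun hg x
    simp only [J0, LinearMap.comp_apply, LinearEquiv.coe_coe, LinearEquiv.apply_symm_apply,
      LinearMap.prodMap_apply, LinearMap.id_apply, LinearMap.inl_apply, LinearMap.fst_apply,
      LinearMap.coprod_apply, LinearMap.inr_apply, h1]
    rw [← map_add, ← map_add]
    simp

theorem aux_equiv_of_ker {L U V : Type u} [AddCommGroup L] [Module R L] [AddCommGroup U]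
    [Module R U] [AddCommGroup V] [Module R V] (f : L →ₗ[R] U) (g : L →ₗ[R] V)
    (hf : Function.Surjective f) (hg : Function.Surjective g)
    (h : LinearMap.ker f = LinearMap.ker g) : Nonempty (U ≃ₗ[R] V) :=
  ⟨(f.quotKerEquivOfSurjective hf).symm.trans
    ((Submodule.quotEquivOfEq _ _ h).trans (g.quotKerEquivOfSurjective hg))⟩

theorem aux_fg_cokernel {N G Y : Type u} [AddCommGroup N] [Module R N]
    [AddCommGroup G] [Module R G] [AddCommGroup Y] [Module R Y] [Module.Projective R G]
    [Module.Finite R N] (ι : N →ₗ[R] G) (π : G →ₗ[R] Y)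
    (hπ : Function.Surjective π) (hex : Function.Exact ι π) :
    ∃ N' : ModuleCat.{u} R, Module.Finite R N' ∧ AuxStable (R := R) N' Y := by
  classical
  let q : (G →₀ R) →ₗ[R] G := Finsupp.linearCombination R id
  have hq : Function.Surjective q := fun x => ⟨Finsupp.single x 1, by simp [q]⟩
  obtain ⟨s, hs⟩ := Module.projective_lifting_property q LinearMap.id hq
  have hs' : ∀ x, q (s x) = x := fun x => LinearMap.congr_fun hs x
  obtain ⟨t, ht⟩ := (Module.Finite.fg_top : (⊤ : Submodule R N).FG)
  let S : Finset G := t.biUnion fun n => (s (ι n)).support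
  have hS : ∀ n, s (ι n) ∈ Finsupp.supported R R (S : Set G) := by
    intro n
    have : (⊤ : Submodule R N) ≤ (Finsupp.supported R R (S : Set G)).comap (s.comp ι) := by
      rw [← ht, Submodule.span_le]
      intro n hn
      change s (ι n) ∈ Finsupp.supported R R (S : Set G)
      rw [Finsupp.mem_supported]
      intro x hx
      exact Finset.mem_coe.2 (Finset.mem_biUnion.2 ⟨n, hn, hx⟩)
    exact this (Submodule.mem_top (x := n))
  let ρ : (G →₀ R) →ₗ[R] ({x // x ∈ S} →₀ R) := Finsupp.lsubtypeDomain (M := R) (R := R) {x | x ∈ S}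
  let ρ' : (G →₀ R) →ₗ[R] ({x // x ∉ S} →₀ R) := Finsupp.lsubtypeDomain (M := R) (R := R) {x | x ∉ S}
  let W : Submodule R ({x // x ∈ S} →₀ R) := LinearMap.range (ρ.comp (s.comp ι))
  have hρ'S : ∀ n, ρ' (s (ι n)) = 0 := by
    intro n
    ext ⟨x, hx⟩
    exact (Finsupp.mem_supported' R _).1 (hS n) x hx
  have hinj : ∀ l, ρ l = 0 → ρ' l = 0 → l = 0 := by
    intro l h1 h2
    ext x
    by_cases hx : x ∈ S
    · exact DFunLike.congr_fun h1 ⟨x, hx⟩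
    · exact DFunLike.congr_fun h2 ⟨x, hx⟩
  have hsurj : ∀ a b, ∃ l, ρ l = a ∧ ρ' l = b := by
    intro a b
    refine ⟨a.embDomain (Function.Embedding.subtype _) +
      b.embDomain (Function.Embedding.subtype _), ?_, ?_⟩
    · ext ⟨x, hx⟩
      have h1 := Finsupp.embDomain_apply_self (Function.Embedding.subtype (fun x => x ∈ S)) a ⟨x, hx⟩
      have h2 : (b.embDomain (Function.Embedding.subtype (fun x => x ∉ S))) x = 0 :=
        Finsupp.embDomain_of_notMem_range _ _ _ (by rintro ⟨⟨y, hy⟩, rfl⟩; exact hy hx)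
      change (a.embDomain (Function.Embedding.subtype _)) x +
        (b.embDomain (Function.Embedding.subtype _)) x = a ⟨x, hx⟩
      rw [h2, add_zero]; exact h1
    · ext ⟨x, hx⟩
      have h1 := Finsupp.embDomain_apply_self (Function.Embedding.subtype (fun x => x ∉ S)) b ⟨x, hx⟩
      have h2 : (a.embDomain (Function.Embedding.subtype (fun x => x ∈ S))) x = 0 :=
        Finsupp.embDomain_of_notMem_range _ _ _ (by rintro ⟨⟨y, hy⟩, rfl⟩; exact hx hy)
      change (a.embDomain (Function.Embedding.subtype _)) x +
        (b.embDomain (Function.Embedding.subtype _)) x = b ⟨x, hx⟩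
      rw [h2, zero_add]; exact h1
  let f : (G →₀ R) →ₗ[R] (({x // x ∈ S} →₀ R) ⧸ W) × ({x // x ∉ S} →₀ R) :=
    (W.mkQ.comp ρ).prod ρ'
  let K := LinearMap.ker q
  let c : (G →₀ R) →ₗ[R] K := LinearMap.codRestrict K (LinearMap.id - s.comp q) (by
    intro l; simp [K, hs'])
  let g : (G →₀ R) →ₗ[R] Y × K := (π.comp q).prod c
  have hK : Module.Projective R K := by
    refine Module.Projective.of_split K.subtype c ?_
    ext ⟨t, ht⟩
    have : q t = 0 := ht
    simp [c, this]
  have hf : Function.Surjective f := by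
    rintro ⟨a, b⟩
    obtain ⟨a, rfl⟩ := W.mkQ_surjective a
    obtain ⟨l, rfl, rfl⟩ := hsurj a b
    exact ⟨l, rfl⟩
  have hg : Function.Surjective g := by
    rintro ⟨y, ⟨k, hk⟩⟩
    obtain ⟨x, rfl⟩ := hπ y
    have hk' : q k = 0 := hk
    refine ⟨s x + k, Prod.ext ?_ (Subtype.ext ?_)⟩
    · simp [g, hs', hk']
    · simp [g, c, hs', hk']
  have hkf : LinearMap.ker f = LinearMap.range (s.comp ι) := by
    ext l
    constructor
    · intro h
      have h0 : f l = 0 := h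
      have h1 : W.mkQ (ρ l) = 0 := congrArg Prod.fst h0
      have h2 : ρ' l = 0 := congrArg Prod.snd h0
      rw [Submodule.mkQ_apply, Submodule.Quotient.mk_eq_zero] at h1
      obtain ⟨n, hn⟩ := h1
      refine ⟨n, ?_⟩
      have hn' : ρ (s (ι n)) = ρ l := hn
      have := hinj (s (ι n) - l) (by rw [map_sub, hn', sub_self]) (by
        rw [map_sub, hρ'S, h2, sub_self])
      exact sub_eq_zero.1 this
    · rintro ⟨n, rfl⟩
      refine Prod.ext ?_ (hρ'S n)
      exact (Submodule.Quotient.mk_eq_zero W).2 ⟨n, rfl⟩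
  have hkg : LinearMap.ker g = LinearMap.range (s.comp ι) := by
    ext l
    constructor
    · intro h
      have h0 : g l = 0 := h
      have h1 : π (q l) = 0 := congrArg Prod.fst h0
      have h2 : l - s (q l) = 0 := congrArg (fun z => (z.2 : G →₀ R)) h0
      obtain ⟨n, hn⟩ := (hex _).1 h1
      refine ⟨n, ?_⟩
      change s (ι n) = l
      rw [hn]; exact (sub_eq_zero.1 h2).symm
    · rintro ⟨n, rfl⟩
      refine Prod.ext ?_ (Subtype.ext ?_)
      · change π (q (s (ι n))) = 0
        rw [hs', hex.apply_apply_eq_zero]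
      · change s (ι n) - s (q (s (ι n))) = 0
        rw [hs', sub_self]
  obtain ⟨E⟩ := aux_equiv_of_ker (V := Y × K) f g hf hg (hkf.trans hkg.symm)
  refine ⟨ModuleCat.of R (({x // x ∈ S} →₀ R) ⧸ W),
    inferInstanceAs (Module.Finite R (({x // x ∈ S} →₀ R) ⧸ W)),
    ModuleCat.of R ({x // x ∉ S} →₀ R), ModuleCat.of R K,
    inferInstanceAs (Module.Projective R ({x // x ∉ S} →₀ R)), hK, ⟨E⟩⟩

end ModAux
section MainAux

variable {R : Type u} [CommRing R]

/-- Each syzygy of the complex is stably finitely generated. -/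
theorem aux_stably_fg {n : ℕ} {M : Type u} [AddCommGroup M] [Module R M] [Module.Finite R M]
    (Z P : ℤ → ModuleCat.{u} R) (j : ∀ i, Z i →ₗ[R] P i) (p : ∀ i : ℤ, P (i + 1) →ₗ[R] Z i)
    (hP : ∀ i, Module.Projective R (P i)) (hj : ∀ i, Function.Injective (j i))
    (hp : ∀ i, Function.Surjective (p i)) (hjp : ∀ i, Function.Exact (j (i + 1)) (p i))
    (hext : ∀ i, AuxExtends (j i)) (hM : ∀ k : ℤ, Nonempty (M ≃ₗ[R] Z ((n : ℤ) * k)))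
    (m : ℕ) : ∀ i k : ℤ, i + m = n * k →
      ∃ N : ModuleCat.{u} R, Module.Finite R N ∧ AuxStable (R := R) N (Z i) := by
  induction m with
  | zero =>
    intro i k h
    obtain rfl : i = n * k := by simpa using h
    obtain ⟨e⟩ := hM k
    exact ⟨ModuleCat.of R M, ‹_›, AuxStable.of_equiv e⟩
  | succ m ih =>
    intro i k h
    obtain ⟨N, hN, hst⟩ := ih (i + 1) k (by rw [← h]; push_cast; ring)
    have := hP (i + 1)
    obtain ⟨G, ι, π, hG, -, hπ, hex, -⟩ := aux_replace (N' := Z i) (j (i + 1)) (p i) (hj _) (hp _)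
      (hjp _) (hext _) hst (AuxStable.of_equiv (LinearEquiv.refl R _))
    exact aux_fg_cokernel ι π hπ hex

theorem aux_stairs {n : ℕ} (hn : 0 < n) {M : Type u} [AddCommGroup M] [Module R M]
    [Module.Finite R M]
    (Z P : ℤ → ModuleCat.{u} R) (j : ∀ i, Z i →ₗ[R] P i) (p : ∀ i : ℤ, P (i + 1) →ₗ[R] Z i)
    (hP : ∀ i, Module.Projective R (P i)) (hj : ∀ i, Function.Injective (j i))
    (hp : ∀ i, Function.Surjective (p i)) (hjp : ∀ i, Function.Exact (j (i + 1)) (p i))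
    (hext : ∀ i, AuxExtends (j i)) (hM : ∀ k : ℤ, Nonempty (M ≃ₗ[R] Z ((n : ℤ) * k))) :
    ∃ (N G : ℤ → ModuleCat.{u} R) (ι : ∀ i, N i →ₗ[R] G i) (π : ∀ i : ℤ, G (i + 1) →ₗ[R] N i),
      (∀ i, Module.Projective R (G i)) ∧ (∀ i, Module.Finite R (N i)) ∧
      (∀ i, Module.Finite R (G i)) ∧
      (∀ i, Function.Injective (ι i)) ∧ (∀ i, Function.Surjective (π i)) ∧
      (∀ i, Function.Exact (ι (i + 1)) (π i)) ∧ (∀ i, AuxExtends (ι i)) ∧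
      ∀ k : ℤ, Nonempty (M ≃ₗ[R] N ((n : ℤ) * k)) := by
  have H1 : ∀ i : ℤ, ∃ N : ModuleCat.{u} R, Module.Finite R N ∧ AuxStable (R := R) N (Z i) ∧
      ∀ k : ℤ, i = n * k → Nonempty (M ≃ₗ[R] N) := by
    intro i
    by_cases h : ∃ k : ℤ, i = n * k
    · obtain ⟨k, rfl⟩ := h
      obtain ⟨e⟩ := hM k
      exact ⟨ModuleCat.of R M, ‹_›, AuxStable.of_equiv e, fun _ _ => ⟨LinearEquiv.refl R M⟩⟩
    · have h0 : 0 ≤ (n : ℤ) * |i| - i := by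
        have h1 : (1 : ℤ) ≤ n := by exact_mod_cast hn
        have h2 := le_abs_self i
        have h3 := abs_nonneg i
        nlinarith
      obtain ⟨m, hm⟩ := Int.eq_ofNat_of_zero_le h0
      obtain ⟨N, hN, hst⟩ := aux_stably_fg Z P j p hP hj hp hjp hext hM m i |i| (by
        rw [← hm]; ring)
      exact ⟨N, hN, hst, fun k hk => (h ⟨k, hk⟩).elim⟩
  choose N hN hst hMN using H1
  have H2 : ∀ i : ℤ, ∃ (G : ModuleCat.{u} R) (ι : N i →ₗ[R] G), Module.Projective R G ∧
      Module.Finite R G ∧ Function.Injective ι ∧ AuxExtends ι ∧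
      ∀ i' : ℤ, i' + 1 = i → ∃ π : G →ₗ[R] N i', Function.Surjective π ∧ Function.Exact ι π := by
    intro i
    obtain ⟨i, rfl⟩ : ∃ i', i = i' + 1 := ⟨i - 1, by ring⟩
    have := hP (i + 1)
    obtain ⟨G, ι, π, hG, hι, hπ, hex, hx⟩ := aux_replace (j (i + 1)) (p i) (hj _) (hp _)
      (hjp _) (hext _) (hst (i + 1)) (hst i)
    have := hN i
    have := hN (i + 1)
    refine ⟨G, ι, hG, Module.Finite.of_exact hex hπ, hι, hx, ?_⟩
    intro i' h
    obtain rfl : i' = i := by linarith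
    exact ⟨π, hπ, hex⟩
  choose G ι hG hGf hι hx H3 using H2
  choose π hπ hex using H3
  exact ⟨N, G, ι, fun i => π (i + 1) i rfl, hG, hN, hGf, hι, fun i => hπ _ _ _,
    fun i => hex _ _ _, hx, fun k => hMN _ k rfl⟩

theorem aux_flat_extend (N G : ℤ → ModuleCat.{u} R) (ι : ∀ i, N i →ₗ[R] G i)
    (π : ∀ i : ℤ, G (i + 1) →ₗ[R] N i)
    (hG : ∀ i, Module.Projective R (G i)) (hN : ∀ i, Module.Finite R (N i))
    (hGf : ∀ i, Module.Finite R (G i)) (hπ : ∀ i, Function.Surjective (π i))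
    (hex : ∀ i, Function.Exact (ι (i + 1)) (π i)) (hx : ∀ i, AuxExtends (ι i)) (m : ℕ) :
    ∀ (F : ModuleCat.{u} R), flatDimLE R m F → ∀ i, ∀ f : N i →ₗ[R] F,
      ∃ g : G i →ₗ[R] F, g.comp (ι i) = f := by
  induction m with
  | zero =>
    intro F hF i f
    have hF' : Module.Flat R F := hF
    have := hG (i + 1)
    have := hGf (i + 1)
    have := hN (i + 1)
    have : Module.FinitePresentation R (G (i + 1)) := Module.finitePresentation_of_projective R _
    have : Module.FinitePresentation R (N i) := by
      refine Module.finitePresentation_of_surjective (π i) (hπ i) ?_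
      rw [LinearMap.exact_iff.1 (hex i)]
      exact Submodule.fg_range _
    obtain ⟨k, a, b, hab⟩ := Module.Flat.exists_factorization_of_finitePresentation f
    obtain ⟨g, hg⟩ := hx i (ModuleCat.of R (Fin k →₀ R))
      (inferInstanceAs (Module.Projective R (Fin k →₀ R))) a
    refine ⟨b.comp g, ?_⟩
    rw [LinearMap.comp_assoc, hg, hab]
  | succ m ih =>
    intro F hF i f
    obtain ⟨F0, q, hF0, hq, hK⟩ := hF
    have h0 : ∀ f : N i →ₗ[R] F0, ∃ g : G i →ₗ[R] F0, g.comp (ι i) = f := by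
      have hF' : Module.Flat R F0 := hF0
      have := hG (i + 1)
      have := hGf (i + 1)
      have := hN (i + 1)
      have : Module.FinitePresentation R (G (i + 1)) := Module.finitePresentation_of_projective R _
      have : Module.FinitePresentation R (N i) := by
        refine Module.finitePresentation_of_surjective (π i) (hπ i) ?_
        rw [LinearMap.exact_iff.1 (hex i)]
        exact Submodule.fg_range _
      intro f
      obtain ⟨k, a, b, hab⟩ := Module.Flat.exists_factorization_of_finitePresentation f
      obtain ⟨g, hg⟩ := hx i (ModuleCat.of R (Fin k →₀ R))
        (inferInstanceAs (Module.Projective R (Fin k →₀ R))) a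
      refine ⟨b.comp g, ?_⟩
      rw [LinearMap.comp_assoc, hg, hab]
    have := hG (i + 1)
    obtain ⟨u, hu⟩ := Module.projective_lifting_property q (f.comp (π i)) hq
    have hu' : ∀ x, q (u x) = f (π i x) := fun x => LinearMap.congr_fun hu x
    obtain ⟨v, hv⟩ := ih _ hK (i + 1) (LinearMap.codRestrict (LinearMap.ker q)
      (u.comp (ι (i + 1))) (by
        intro x
        rw [LinearMap.mem_ker, LinearMap.comp_apply, hu', (hex i).apply_apply_eq_zero, map_zero]))
    change G (i + 1) →ₗ[R] LinearMap.ker q at v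
    have hv' : ∀ x, (v (ι (i + 1) x) : F0) = u (ι (i + 1) x) := fun x =>
      congrArg Subtype.val (LinearMap.congr_fun hv x)
    let w : G (i + 1) →ₗ[R] F0 := u - (LinearMap.ker q).subtype.comp v
    have hw : LinearMap.ker (π i) ≤ LinearMap.ker w := by
      intro x hxx
      obtain ⟨y, rfl⟩ := (hex i x).1 hxx
      simp [w, hv']
    obtain ⟨f0, hf0⟩ : ∃ f0 : N i →ₗ[R] F0, f0.comp (π i) = w := by
      refine ⟨((LinearMap.ker (π i)).liftQ w hw).comp
        ((π i).quotKerEquivOfSurjective (hπ i)).symm.toLinearMap, ?_⟩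
      refine LinearMap.ext fun x => ?_
      have : ((π i).quotKerEquivOfSurjective (hπ i)).symm (π i x) = Submodule.Quotient.mk x := by
        rw [LinearEquiv.symm_apply_eq]; rfl
      simp [this]
    obtain ⟨g0, hg0⟩ := h0 f0
    refine ⟨q.comp g0, ?_⟩
    rw [LinearMap.comp_assoc, hg0]
    refine LinearMap.ext fun x => ?_
    obtain ⟨y, rfl⟩ := hπ i x
    have h1 : f0 (π i y) = u y - (v y : F0) := LinearMap.congr_fun hf0 y
    have h2 : q (v y : F0) = 0 := (v y).2
    rw [LinearMap.comp_apply, h1, map_sub, h2, hu', sub_zero]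

theorem aux_hom_exact (N G : ℤ → ModuleCat.{u} R) (ι : ∀ i, N i →ₗ[R] G i)
    (π : ∀ i : ℤ, G (i + 1) →ₗ[R] N i) (hπ : ∀ i, Function.Surjective (π i))
    (hex : ∀ i, Function.Exact (ι (i + 1)) (π i)) (F : ModuleCat.{u} R)
    (hF : ∀ i, ∀ f : N i →ₗ[R] F, ∃ g : G i →ₗ[R] F, g.comp (ι i) = f) (i : ℤ) :
    Function.Exact (fun g : G i →ₗ[R] F => g.comp ((ι i).comp (π i)))
      (fun g : G (i + 1) →ₗ[R] F => g.comp ((ι (i + 1)).comp (π (i + 1)))) := by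
  intro w
  constructor
  · intro h
    have hw : LinearMap.ker (π i) ≤ LinearMap.ker w := by
      intro x hxx
      obtain ⟨y, rfl⟩ := (hex i x).1 hxx
      obtain ⟨z, rfl⟩ := hπ (i + 1) y
      exact LinearMap.congr_fun h z
    obtain ⟨f0, hf0⟩ : ∃ f0 : N i →ₗ[R] F, f0.comp (π i) = w := by
      refine ⟨((LinearMap.ker (π i)).liftQ w hw).comp
        ((π i).quotKerEquivOfSurjective (hπ i)).symm.toLinearMap, ?_⟩
      refine LinearMap.ext fun x => ?_
      have : ((π i).quotKerEquivOfSurjective (hπ i)).symm (π i x) = Submodule.Quotient.mk x := by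
        rw [LinearEquiv.symm_apply_eq]; rfl
      simp [this]
    obtain ⟨g, hg⟩ := hF i f0
    refine ⟨g, ?_⟩
    change g.comp ((ι i).comp (π i)) = w
    rw [← LinearMap.comp_assoc, hg, hf0]
  · rintro ⟨g, rfl⟩
    refine LinearMap.ext fun x => ?_
    change g (ι i (π i (ι (i + 1) (π (i + 1) x)))) = 0
    rw [(hex i).apply_apply_eq_zero, map_zero, map_zero]

/-- The sequence `a, a + 1, a + 1 + 1, …`. -/
def auxShift (a : ℤ) : ℕ → ℤ
  | 0 => a
  | m + 1 => auxShift a m + 1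

theorem auxShift_eq (a : ℤ) (m : ℕ) : auxShift a m = a + m := by
  induction m with
  | zero => simp [auxShift]
  | succ m ih => rw [auxShift, ih]; push_cast; ring

theorem aux_ext_iff {M : Type u} [AddCommGroup M] [Module R M] (P : ℤ → ModuleCat.{u} R)
    (d : ∀ i : ℤ, P (i + 1) →ₗ[R] P i) (hP : ∀ i, Module.Projective R (P i))
    (hd : ∀ i : ℤ, Function.Exact (d (i + 1)) (d i)) (a : ℤ)
    (hM : Nonempty (M ≃ₗ[R] LinearMap.range (d a))) (F : ModuleCat.{u} R) (m : ℕ) :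
    Subsingleton (((Ext ℤ (ModuleCat.{u} R) (m + 1)).obj
      (Opposite.op (ModuleCat.of R M))).obj F) ↔
    Function.Exact (fun g : P (auxShift (a + 1) m) →ₗ[R] F => g.comp (d (auxShift (a + 1) m)))
      (fun g : P (auxShift (a + 1) m + 1) →ₗ[R] F => g.comp (d (auxShift (a + 1) m + 1))) := by
  obtain ⟨e⟩ := hM
  refine auxExt (M := ModuleCat.of R M) (fun m => P (auxShift (a + 1) m))
    (fun m => d (auxShift (a + 1) m))
    (e.symm.toLinearMap.comp (d a).rangeRestrict) (fun m => hP _) (fun m => hd _) ?_ ?_ F m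
  · exact e.symm.surjective.comp (d a).surjective_rangeRestrict
  · intro x
    refine Iff.trans ?_ (hd a x)
    constructor
    · intro h
      have h1 : (d a).rangeRestrict x = 0 := e.symm.injective (h.trans (map_zero _).symm)
      exact congrArg Subtype.val h1
    · intro h
      have h1 : (d a).rangeRestrict x = 0 := Subtype.ext h
      change e.symm ((d a).rangeRestrict x) = 0
      rw [h1, map_zero]

end MainAux

/-- A finitely generated module `M` is `n`-strongly Gorenstein projective iff there is
an exact sequence `0 → M → P_{n-1} → ⋯ → P_0 → M → 0` of finitely generated
projectives, and `Ext^i(M, F) = 0` for every module `F` of finite flat dimension and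
all `i ≥ 1`. -/
theorem nSGProjective_iff_fg_seq_ext_flat_vanishes (R : Type u) [CommRing R] (n : ℕ)
    (hn : 0 < n) (M : Type u) [AddCommGroup M] [Module R M] [Module.Finite R M] :
    IsNSGProjective R n M ↔
      ∃ (P : ℤ → ModuleCat.{u} R) (d : ∀ i : ℤ, P (i + 1) →ₗ[R] P i),
        (∀ i, Module.Projective R (P i) ∧ Module.Finite R (P i)) ∧
        IsPeriodicExact R n M P d ∧
        ∀ (F : ModuleCat.{u} R), (∃ m : ℕ, flatDimLE R m F) → ∀ i : ℕ, 1 ≤ i →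
          Subsingleton (((Ext ℤ (ModuleCat.{u} R) i).obj
            (Opposite.op (ModuleCat.of R M))).obj F) := by 
  constructor
  · rintro ⟨P, d, hP, ⟨hd, hM⟩, hH⟩
    obtain ⟨N, G, ι, π, hG, hN, hGf, hι, hπ, hex, hx, hMN⟩ := aux_stairs (R := R) hn (M := M)
      (fun i => ModuleCat.of R (LinearMap.range (d i))) P
      (fun i => (LinearMap.range (d i)).subtype) (fun i => (d i).rangeRestrict) hP
      (fun i => (LinearMap.range (d i)).injective_subtype)
      (fun i => (d i).surjective_rangeRestrict)
      (by
        intro i x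
        refine Iff.trans ?_ ((hd i x).trans ?_)
        · constructor
          · intro h
            exact congrArg Subtype.val h
          · intro h
            exact Subtype.ext h
        · constructor
          · rintro ⟨y, hy⟩
            exact ⟨⟨x, y, hy⟩, rfl⟩
          · rintro ⟨⟨z, y, hy⟩, hz⟩
            exact ⟨y, hy.trans hz⟩)
      (by
        intro i Q hQ f
        obtain ⟨i, rfl⟩ : ∃ i', i = i' + 1 := ⟨i - 1, by ring⟩
        change LinearMap.range (d (i + 1)) →ₗ[R] Q at f
        obtain ⟨g, hg⟩ := (hH Q hQ (i + 1) (f.comp (d (i + 1)).rangeRestrict)).1 (by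
          refine LinearMap.ext fun x => ?_
          have h1 : (d (i + 1)).rangeRestrict (d (i + 1 + 1) x) = 0 :=
            Subtype.ext ((hd (i + 1)).apply_apply_eq_zero x)
          change f ((d (i + 1)).rangeRestrict (d (i + 1 + 1) x)) = 0
          rw [h1, map_zero])
        refine ⟨g, LinearMap.ext fun x => ?_⟩
        obtain ⟨y, rfl⟩ := (d (i + 1)).surjective_rangeRestrict x
        exact LinearMap.congr_fun hg y)
      hM
    have hdex : ∀ i : ℤ, Function.Exact ((ι (i + 1)).comp (π (i + 1))) ((ι i).comp (π i)) := by
      intro i x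
      constructor
      · intro h
        have h1 : π i x = 0 := hι i (h.trans (map_zero _).symm)
        obtain ⟨y, rfl⟩ := (hex i x).1 h1
        obtain ⟨z, rfl⟩ := hπ (i + 1) y
        exact ⟨z, rfl⟩
      · rintro ⟨z, rfl⟩
        change ι i (π i (ι (i + 1) (π (i + 1) z))) = 0
        rw [(hex i).apply_apply_eq_zero, map_zero]
    have hper : ∀ k : ℤ, Nonempty (M ≃ₗ[R]
        LinearMap.range ((ι ((n : ℤ) * k)).comp (π ((n : ℤ) * k)))) := by
      intro k
      obtain ⟨e⟩ := hMN k
      have hr : LinearMap.range ((ι ((n : ℤ) * k)).comp (π ((n : ℤ) * k))) =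
          LinearMap.range (ι ((n : ℤ) * k)) :=
        LinearMap.range_comp_of_range_eq_top _ (LinearMap.range_eq_top.2 (hπ _))
      rw [hr]
      exact ⟨e.trans (LinearEquiv.ofInjective _ (hι _))⟩
    refine ⟨G, fun i => (ι i).comp (π i), fun i => ⟨hG i, hGf i⟩, ⟨hdex, hper⟩, ?_⟩
    rintro F ⟨m, hF⟩ i hi
    obtain ⟨i, rfl⟩ : ∃ i', i = i' + 1 := ⟨i - 1, by omega⟩
    rw [aux_ext_iff G (fun i => (ι i).comp (π i)) hG hdex _ (hper 0)]
    exact aux_hom_exact N G ι π hπ hex F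
      (aux_flat_extend N G ι π hG hN hGf hπ hex hx m F hF) _
  · rintro ⟨P, d, hP, ⟨hd, hM⟩, hE⟩
    refine ⟨P, d, fun i => (hP i).1, ⟨hd, hM⟩, ?_⟩
    intro Q hQ i
    obtain ⟨k, h0⟩ : ∃ k : ℤ, 0 ≤ i - ((n : ℤ) * k + 1) := by
      refine ⟨-(|i| + 1), ?_⟩
      have h1 : (1 : ℤ) ≤ n := by exact_mod_cast hn
      have h2 := neg_abs_le i
      have h3 := abs_nonneg i
      nlinarith
    obtain ⟨m, hm⟩ := Int.eq_ofNat_of_zero_le h0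
    obtain rfl : auxShift ((n : ℤ) * k + 1) m = i := by
      rw [auxShift_eq, ← hm]; ring
    exact (aux_ext_iff P d (fun i => (hP i).1) hd _ (hM _) Q m).1
      (hE Q ⟨0, (inferInstance : Module.Flat R Q)⟩ (m + 1) (by omega))
end

section
/- A module M is n-strongly Gorenstein flat if and only if there exists an exact sequence 0 → M →^{h_n} F_{n−1} → ⋯ → F₀ →^{h_0} M → 0 with each F_i flat such that ⊕_{i=1}^{n} Im(h_i) is 1-strongly Gorenstein flat. -/
open CategoryTheory DirectSum

universe u

open TensorProduct

/-- Diagram chase in the 3x3 grid. -/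
theorem sgf_chase {R : Type u} [CommRing R] {A B C X Y Z : Type u}
    [AddCommGroup A] [Module R A] [AddCommGroup B] [Module R B] [AddCommGroup C] [Module R C]
    [AddCommGroup X] [Module R X] [AddCommGroup Y] [Module R Y] [AddCommGroup Z] [Module R Z]
    (f : A →ₗ[R] B) (g : B →ₗ[R] C) (hfg : Function.Exact f g) (hg : Function.Surjective g)
    (p : X →ₗ[R] Y) (q : Y →ₗ[R] Z) (hp : Function.Injective p)
    (hpq : Function.Exact p q) (hq : Function.Surjective q)
    [Module.Flat R B] (h : Function.Injective (f.rTensor Z)) :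
    Function.Injective (p.lTensor C) := by
  rw [injective_iff_map_eq_zero]
  intro t ht
  obtain ⟨s, rfl⟩ := LinearMap.rTensor_surjective X hg t
  have h1 : (g.rTensor Y) (p.lTensor B s) = 0 := by
    rw [← ht, ← LinearMap.comp_apply, ← LinearMap.comp_apply, LinearMap.rTensor_comp_lTensor,
      LinearMap.lTensor_comp_rTensor]
  obtain ⟨a, ha⟩ := (rTensor_exact Y hfg hg _).1 h1
  have h2 : (f.rTensor Z) (q.lTensor A a) = 0 := by
    have : (f.rTensor Z) (q.lTensor A a) = q.lTensor B (f.rTensor Y a) := by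
      rw [← LinearMap.comp_apply, ← LinearMap.comp_apply, LinearMap.rTensor_comp_lTensor,
        LinearMap.lTensor_comp_rTensor]
    rw [this, ha, (lTensor_exact B hpq hq).apply_apply_eq_zero]
  have h3 := (injective_iff_map_eq_zero _).1 h _ h2
  obtain ⟨a', rfl⟩ := (lTensor_exact A hpq hq _).1 h3
  have h4 : p.lTensor B s = p.lTensor B (f.rTensor X a') := by
    rw [← ha, ← LinearMap.comp_apply, ← LinearMap.comp_apply, LinearMap.rTensor_comp_lTensor,
      LinearMap.lTensor_comp_rTensor]
  rw [Module.Flat.lTensor_preserves_injective_linearMap p hp h4]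
  exact (rTensor_exact X hfg hg).apply_apply_eq_zero a'

theorem sgf_inj_swap {R : Type u} [CommRing R] {A X Y : Type u}
    [AddCommGroup A] [Module R A]
    [AddCommGroup X] [Module R X] [AddCommGroup Y] [Module R Y] (p : X →ₗ[R] Y) :
    Function.Injective (p.lTensor A) ↔ Function.Injective (p.rTensor A) :=
  LinearMap.lTensor_inj_iff_rTensor_inj A p

/-- `Tor₁(I, S) = 0`, elementary form. -/
def SgfTV (R : Type u) [CommRing R] (I S : Type u) [AddCommGroup I] [Module R I]
    [AddCommGroup S] [Module R S] : Prop :=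
  ∀ (K E : ModuleCat.{u} R) (f : K →ₗ[R] E) (g : E →ₗ[R] S), Function.Injective f →
    Function.Exact f g → Function.Surjective g → Function.Injective (f.lTensor I)

theorem sgf_retract {R : Type u} [CommRing R] {L P S N : Type u} [AddCommGroup L] [Module R L]
    [AddCommGroup P] [Module R P]
    [AddCommGroup S] [Module R S] [AddCommGroup N] [Module R N] (i : L →ₗ[R] P)
    (h1 : Function.Injective (i.lTensor N)) (s : S →ₗ[R] N) (r : N →ₗ[R] S)
    (hrs : r.comp s = LinearMap.id) : Function.Injective (i.lTensor S) := by
  have hs : Function.Injective (s.rTensor L) := by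
    apply Function.LeftInverse.injective (g := r.rTensor L)
    intro x
    rw [← LinearMap.comp_apply, ← LinearMap.rTensor_comp, hrs, LinearMap.rTensor_id,
      LinearMap.id_apply]
  have h3 : Function.Injective ((i.lTensor N).comp (s.rTensor L)) := by
    rw [LinearMap.coe_comp]
    exact h1.comp hs
  rw [LinearMap.lTensor_comp_rTensor, ← LinearMap.rTensor_comp_lTensor,
    LinearMap.coe_comp] at h3
  exact h3.of_comp

theorem sgfTV_aux {R : Type u} [CommRing R] {I S N N1 F L P : Type u}
    [AddCommGroup I] [Module R I] [AddCommGroup L] [Module R L] [AddCommGroup P] [Module R P]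
    [AddCommGroup S] [Module R S] [AddCommGroup N] [Module R N] [AddCommGroup N1] [Module R N1]
    [AddCommGroup F] [Module R F] [Module.Flat R F] (f : N1 →ₗ[R] F) (g : F →ₗ[R] N)
    (hfg : Function.Exact f g) (hg : Function.Surjective g)
    (h : Function.Injective (f.lTensor I)) (s : S →ₗ[R] N) (r : N →ₗ[R] S)
    (hrs : r.comp s = LinearMap.id) [Module.Flat R P] (i : L →ₗ[R] P) (π : P →ₗ[R] I)
    (hi : Function.Injective i) (hex : Function.Exact i π) (hπ : Function.Surjective π) :
    SgfTV R I S := by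
  intro K E p q hp hpq hq
  have h1 : Function.Injective (i.lTensor N) :=
    sgf_chase f g hfg hg i π hi hex hπ ((sgf_inj_swap f).1 h)
  have h2 : Function.Injective (i.lTensor S) := sgf_retract i h1 s r hrs
  exact sgf_chase i π hex hπ p q hp hpq hq ((sgf_inj_swap _).1 h2)

theorem sgfTV_of {R : Type u} [CommRing R] {I S N N1 F : Type u} [AddCommGroup I] [Module R I]
    [AddCommGroup S] [Module R S] [AddCommGroup N] [Module R N] [AddCommGroup N1] [Module R N1]
    [AddCommGroup F] [Module R F] [Module.Flat R F] (f : N1 →ₗ[R] F) (g : F →ₗ[R] N)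
    (hfg : Function.Exact f g) (hg : Function.Surjective g)
    (h : Function.Injective (f.lTensor I)) (s : S →ₗ[R] N) (r : N →ₗ[R] S)
    (hrs : r.comp s = LinearMap.id) : SgfTV R I S := by
  have key : ∃ (P : ModuleCat.{u} R) (π : P →ₗ[R] I), Module.Flat R P ∧
      Function.Surjective π :=
    ⟨ModuleCat.of R (I →₀ R), Finsupp.linearCombination R (id : I → I),
      inferInstanceAs (Module.Flat R (I →₀ R)), Finsupp.linearCombination_id_surjective R I⟩
  obtain ⟨P, π, hP, hπ⟩ := key
  exact sgfTV_aux f g hfg hg h s r hrs (LinearMap.ker π).subtype π (Submodule.subtype_injective _)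
    (LinearMap.exact_subtype_ker_map _) hπ

theorem sgf_range_inj {R : Type u} [CommRing R] {I X Y Z : Type u} [AddCommGroup I] [Module R I]
    [AddCommGroup X] [Module R X] [AddCommGroup Y] [Module R Y] [AddCommGroup Z] [Module R Z]
    (a : X →ₗ[R] Y) (b : Y →ₗ[R] Z) (hab : Function.Exact a b)
    (h : Function.Exact (a.lTensor I) (b.lTensor I)) :
    Function.Injective ((LinearMap.range b).subtype.lTensor I) := by
  rw [injective_iff_map_eq_zero]
  intro t ht
  obtain ⟨s, rfl⟩ := LinearMap.lTensor_surjective I b.surjective_rangeRestrict t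
  rw [← LinearMap.comp_apply, ← LinearMap.lTensor_comp, LinearMap.subtype_comp_codRestrict] at ht
  obtain ⟨v, rfl⟩ := (h s).1 ht
  rw [← LinearMap.comp_apply, ← LinearMap.lTensor_comp]
  have : b.rangeRestrict.comp a = 0 := by
    ext x
    simpa using hab.apply_apply_eq_zero x
  rw [this]; simp

theorem sgf_exact_comp {A B C D E : Type u} [AddCommGroup E] [AddCommGroup C] [AddCommGroup B]
    (e : A → B) (f : B → C) (g : C → D) (k : D → E) [Zero D] (he : Function.Surjective e)
    (hfg : Function.Exact f g) (hk : ∀ x, k x = 0 → x = 0) (hk0 : k 0 = 0) :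
    Function.Exact (f ∘ e) (k ∘ g) := by
  intro x
  constructor
  · intro hx
    obtain ⟨y, rfl⟩ := (hfg x).1 (hk _ hx)
    obtain ⟨z, rfl⟩ := he y
    exact ⟨z, rfl⟩
  · rintro ⟨z, rfl⟩
    have : g (f (e z)) = 0 := (hfg _).2 ⟨_, rfl⟩
    simp [this, hk0]

/-- Splicing short exact sequences. -/
theorem sgf_splice {R : Type u} [CommRing R] (n : ℕ) (M : Type u) [AddCommGroup M] [Module R M]
    (S F : ℤ → ModuleCat.{u} R) (hF : ∀ i, Module.Flat R (F i))
    (f : ∀ i, S (i + 1) →ₗ[R] F i) (g : ∀ i, F i →ₗ[R] S i)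
    (hf : ∀ i, Function.Injective (f i)) (hg : ∀ i, Function.Surjective (g i))
    (hfg : ∀ i, Function.Exact (f i) (g i))
    (hI : ∀ I : ModuleCat.{u} R, Module.Injective R I → ∀ i,
      Function.Injective ((f i).lTensor I))
    (hM : ∀ k : ℤ, Nonempty (M ≃ₗ[R] S ((n : ℤ) * k + 1))) : IsNSGFlat R n M := by
  refine ⟨F, fun i => (f i).comp (g (i + 1)), hF, ⟨fun i => ?_, fun k => ?_⟩, fun I hI' i => ?_⟩
  · exact sgf_exact_comp (g (i + 1 + 1)) (f (i + 1)) (g (i + 1)) (f i) (hg _) (hfg _)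
      ((injective_iff_map_eq_zero _).1 (hf i)) (map_zero _)
  · obtain ⟨e⟩ := hM k
    refine ⟨e.trans ((LinearEquiv.ofInjective _ (hf _)).trans (LinearEquiv.ofEq _ _ ?_))⟩
    rw [LinearMap.range_comp_of_range_eq_top]
    exact LinearMap.range_eq_top.2 (hg _)
  · rw [LinearMap.lTensor_comp, LinearMap.lTensor_comp, LinearMap.coe_comp, LinearMap.coe_comp]
    exact sgf_exact_comp _ _ _ _ (LinearMap.lTensor_surjective I (hg _))
      (lTensor_exact I (hfg _) (hg _))
      ((injective_iff_map_eq_zero _).1 (hI I hI' i)) (map_zero _)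

/-- The periodic segment. -/
theorem sgf_seg {R : Type u} [CommRing R] (n : ℕ) (M : Type u) [AddCommGroup M] [Module R M]
    (P : ℤ → ModuleCat.{u} R) (d : ∀ i : ℤ, P (i + 1) →ₗ[R] P i)
    (h : IsPeriodicExact R n M P d) (j k : ℕ) (hj : j < n) (hk : k = (j + 1) % n) :
    ∃ f : LinearMap.range (d (k : ℤ)) →ₗ[R] P ((j : ℤ) + 1), Function.Injective f ∧
      Function.Exact f (d j).rangeRestrict := by
  have key : Nonempty (LinearMap.range (d (k : ℤ)) ≃ₗ[R] LinearMap.range (d ((j : ℤ) + 1))) := by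
    have aux : ∀ a b : ℤ, a = b →
        Nonempty (LinearMap.range (d a) ≃ₗ[R] LinearMap.range (d b)) := by
      rintro a _ rfl
      exact ⟨LinearEquiv.refl _ _⟩
    by_cases hjn : j + 1 < n
    · rw [Nat.mod_eq_of_lt hjn] at hk
      exact aux _ _ (by simp [hk])
    · have hjn' : j + 1 = n := by omega
      rw [hjn', Nat.mod_self] at hk
      obtain ⟨e0⟩ := h.2 0
      obtain ⟨e1⟩ := h.2 1
      obtain ⟨a⟩ := aux (k : ℤ) ((n : ℤ) * 0) (by simp [hk])
      obtain ⟨b⟩ := aux ((n : ℤ) * 1) ((j : ℤ) + 1) (by omega)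
      exact ⟨a.trans (e0.symm.trans (e1.trans b))⟩
  obtain ⟨e⟩ := key
  refine ⟨(LinearMap.range (d ((j : ℤ) + 1))).subtype.comp e.toLinearMap,
    (Submodule.subtype_injective _).comp e.injective, fun x => ?_⟩
  have : (d j).rangeRestrict x = 0 ↔ d j x = 0 := by
    rw [← Subtype.coe_inj]; rfl
  rw [this, h.1 j x]
  constructor
  · rintro ⟨y, rfl⟩
    exact ⟨e.symm ⟨_, y, rfl⟩, by simp⟩
  · rintro ⟨y, rfl⟩
    exact (e y).2

theorem sgf_lmap_lTensor_inj {R : Type u} [CommRing R] {ι : Type} [DecidableEq ι] (I : Type u)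
    [AddCommGroup I] [Module R I]
    (A B : ι → Type u) [∀ i, AddCommGroup (A i)] [∀ i, Module R (A i)]
    [∀ i, AddCommGroup (B i)] [∀ i, Module R (B i)] (f : ∀ i, A i →ₗ[R] B i)
    (hf : ∀ i, Function.Injective ((f i).lTensor I)) :
    Function.Injective ((DirectSum.lmap f).lTensor I) := by
  have h : (TensorProduct.directSumRight R R I B).toLinearMap ∘ₗ (DirectSum.lmap f).lTensor I =
      DirectSum.lmap (fun i => (f i).lTensor I) ∘ₗ
        (TensorProduct.directSumRight R R I A).toLinearMap := by
    refine TensorProduct.ext' fun x y => ?_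
    ext i
    simp [TensorProduct.directSumRight_tmul]
  have h2 : Function.Injective (DirectSum.lmap (fun i => (f i).lTensor I) ∘ₗ
        (TensorProduct.directSumRight R R I A).toLinearMap) := by
    rw [LinearMap.coe_comp]
    refine Function.Injective.comp ?_ (TensorProduct.directSumRight R R I A).injective
    exact (DirectSum.lmap_injective _).2 hf
  rw [← h, LinearMap.coe_comp] at h2
  exact Function.Injective.of_comp h2

/-- `M` is `n`-strongly Gorenstein flat iff there is an exact sequence
`0 → M → F_{n-1} → ⋯ → F_0 → M → 0` with all `F i` flat such that the direct sum of
the images is `1`-strongly Gorenstein flat. -/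
theorem nSGFlat_iff_syzygies_oneSGFlat (R : Type u) [CommRing R] (n : ℕ) (hn : 0 < n)
    (M : Type u) [AddCommGroup M] [Module R M] :
    IsNSGFlat R n M ↔
      ∃ (P : ℤ → ModuleCat.{u} R) (d : ∀ i : ℤ, P (i + 1) →ₗ[R] P i),
        (∀ i, Module.Flat R (P i)) ∧ IsPeriodicExact R n M P d ∧
        IsNSGFlat R 1 (⨁ i : Fin n, LinearMap.range (d ((i : ℕ) : ℤ))) := by
  constructor
  · rintro ⟨P, d, hP, hper, hT⟩
    refine ⟨P, d, hP, hper, ?_⟩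
    have hσ : ∃ σ : Equiv.Perm (Fin n), ∀ i, ((σ i : Fin n) : ℕ) = ((i : ℕ) + 1) % n := by
      obtain ⟨m, rfl⟩ : ∃ m, n = m + 1 := ⟨n - 1, by omega⟩
      exact ⟨finRotate (m + 1), fun i => by simp [Fin.val_add]⟩
    obtain ⟨σ, hσ⟩ := hσ
    choose f hf hfg using fun i : Fin n => sgf_seg n M P d hper i (σ i) i.2 (hσ i)
    have hTV : ∀ I : ModuleCat.{u} R, Module.Injective R I → ∀ i : ℤ,
        SgfTV R I (LinearMap.range (d i)) := by
      intro I hI i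
      have := hP (i + 1)
      refine sgfTV_of (LinearMap.range (d (i + 1))).subtype (d i).rangeRestrict ?_
        (d i).surjective_rangeRestrict
        (sgf_range_inj _ _ (hper.1 (i + 1)) (hT I hI (i + 1))) LinearMap.id LinearMap.id rfl
      intro x
      rw [← Subtype.coe_inj]
      simpa using hper.1 i x
    let e : (⨁ i : Fin n, LinearMap.range (d ((i : ℕ) : ℤ))) ≃ₗ[R]
        (⨁ i : Fin n, LinearMap.range (d (((σ i : Fin n) : ℕ) : ℤ))) :=
      DirectSum.lequivCongrLeft R σ.symm
    let N : ModuleCat.{u} R :=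
      ModuleCat.of R (⨁ i : Fin n, LinearMap.range (d ((i : ℕ) : ℤ)))
    let F : ModuleCat.{u} R := ModuleCat.of R (⨁ i : Fin n, P (((i : ℕ) : ℤ) + 1))
    have hF : Module.Flat R F := by
      have := fun i : Fin n => hP (((i : ℕ) : ℤ) + 1)
      exact inferInstanceAs (Module.Flat R (⨁ i : Fin n, P (((i : ℕ) : ℤ) + 1)))
    let f' : N →ₗ[R] F := (DirectSum.lmap f).comp e.toLinearMap
    let g' : F →ₗ[R] N := DirectSum.lmap (fun i : Fin n => (d ((i : ℕ) : ℤ)).rangeRestrict)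
    refine sgf_splice 1 _ (fun _ => N) (fun _ => F) (fun _ => hF) (fun _ => f') (fun _ => g')
      (fun _ => ?_) (fun _ => ?_) (fun _ => ?_) (fun I hI _ => ?_)
      (fun _ => ⟨LinearEquiv.refl _ _⟩)
    · exact ((DirectSum.lmap_injective _).2 hf).comp e.injective
    · exact (DirectSum.lmap_surjective _).2 (fun i => LinearMap.surjective_rangeRestrict _)
    · intro x
      constructor
      · intro hx
        have hx' : ∀ i : Fin n, ∃ y, f i y = x i := fun i => by
          refine (hfg i _).1 ?_
          have := DFunLike.congr_fun hx i
          exact this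
        choose y hy using hx'
        let z : ⨁ i : Fin n, LinearMap.range (d (((σ i : Fin n) : ℕ) : ℤ)) :=
          DFinsupp.equivFunOnFintype.symm y
        refine ⟨e.symm z, ?_⟩
        change DirectSum.lmap f (e (e.symm z)) = x
        rw [e.apply_symm_apply]
        refine DFinsupp.ext fun i => ?_
        exact hy i
      · rintro ⟨y, rfl⟩
        refine DFinsupp.ext fun i => ?_
        exact (hfg i).apply_apply_eq_zero (e y i)
    · change Function.Injective (LinearMap.lTensor I ((DirectSum.lmap f).comp e.toLinearMap))
      rw [LinearMap.lTensor_comp, LinearMap.coe_comp]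
      refine Function.Injective.comp (sgf_lmap_lTensor_inj I _ _ f fun i => ?_)
        (LinearEquiv.lTensor I e).injective
      exact hTV I hI i (ModuleCat.of R _) _ (f i) _ (hf i) (hfg i)
        (LinearMap.surjective_rangeRestrict _)
  · rintro ⟨P, d, hP, hper, Q, δ, hQ, hQper, hQT⟩
    have hTV : ∀ I : ModuleCat.{u} R, Module.Injective R I → ∀ j : ℕ, j < n →
        SgfTV R I (LinearMap.range (d (j : ℤ))) := by
      intro I hI j hj
      obtain ⟨e⟩ := hQper.2 0
      have := hQ ((((1 : ℕ) : ℤ) * 0) + 1)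
      refine sgfTV_of (LinearMap.range (δ ((((1 : ℕ) : ℤ) * 0) + 1))).subtype
        (δ (((1 : ℕ) : ℤ) * 0)).rangeRestrict ?_
        (LinearMap.surjective_rangeRestrict _)
        (sgf_range_inj _ _ (hQper.1 _) (hQT I hI _))
        (e.toLinearMap.comp (DirectSum.lof R (Fin n)
          (fun i : Fin n => LinearMap.range (d ((i : ℕ) : ℤ))) ⟨j, hj⟩))
        ((DirectSum.component R (Fin n)
          (fun i : Fin n => LinearMap.range (d ((i : ℕ) : ℤ))) ⟨j, hj⟩).comp
          e.symm.toLinearMap) ?_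
      · intro x
        rw [← Subtype.coe_inj]
        simpa using hQper.1 _ x
      · ext x
        simp [DirectSum.component.lof_self]
    let j : ℤ → ℕ := fun i => ((i - 1) % (n : ℤ)).toNat
    have hn' : (0 : ℤ) < n := by exact_mod_cast hn
    have hjz : ∀ i, ((j i : ℕ) : ℤ) = (i - 1) % (n : ℤ) := fun i =>
      Int.toNat_of_nonneg (Int.emod_nonneg _ hn'.ne')
    have hj : ∀ i, j i < n := fun i => by
      have := Int.emod_lt_of_pos (i - 1) hn'
      have := hjz i
      omega
    have hjs : ∀ i, j (i + 1) = (j i + 1) % n := fun i => by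
      zify
      rw [hjz, hjz, Int.emod_add_emod]
      congr 1
      ring
    choose f hf hfg using fun i : ℤ => sgf_seg n M P d hper (j i) (j (i + 1)) (hj i) (hjs i)
    refine sgf_splice n M (fun i => ModuleCat.of R (LinearMap.range (d (j i : ℤ))))
      (fun i => P ((j i : ℤ) + 1)) (fun i => hP _) f (fun i => (d (j i : ℤ)).rangeRestrict)
      hf (fun i => LinearMap.surjective_rangeRestrict _) hfg (fun I hI i => ?_) (fun k => ?_)
    · exact hTV I hI (j i) (hj i) (ModuleCat.of R _) _ (f i) _ (hf i) (hfg i)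
        (LinearMap.surjective_rangeRestrict _)
    · have h0 : ((j ((n : ℤ) * k + 1) : ℕ) : ℤ) = (n : ℤ) * 0 := by
        rw [hjz]; simp
      change Nonempty (M ≃ₗ[R] LinearMap.range (d ((j ((n : ℤ) * k + 1) : ℕ) : ℤ)))
      rw [h0]
      exact hper.2 0
end
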